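/- arXiv:2307.12669 — 2 statements merged into one kernel-verified Lean document; each statement's English description precedes it below -/
import Mathlib

section
/- Let n ≥ 2, let K be a field, let C_n be the graph obtained from the ladder graph A_n by adjoining two new vertices y_{n+1}, y_{n+2} together with the edges {y_n,y_{n+1}} and {y_1,y_{n+2}}, and let S = K[V(C_n)]. Then pdim(S/I(C_n)) = 2n − ⌈n/2⌉ + 1 if n ≡ 0 or 3 (mod 4), pdim(S/I(C_n)) = 2n − ⌈(n+1)/2⌉ + 2 if n ≡ 1 (mod 4), and pdim(S/I(C_n)) = 2n − ⌈(n+1)/2⌉ + 1 if n ≡ 2 (mod 4). -/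
open MvPolynomial

/-- The edge ideal of a simple graph `G`, inside `K[x_v : v ∈ V]`. -/
noncomputable def edgeIdeal (K : Type*) [Field K] {V : Type*} (G : SimpleGraph V) :
    Ideal (MvPolynomial V K) :=
  Ideal.span {m | ∃ i j : V, G.Adj i j ∧ m = X i * X j}

/-- The graded maximal ideal of `K[x_v : v ∈ V]`. -/
noncomputable def maxIdeal (K : Type*) [Field K] (V : Type*) : Ideal (MvPolynomial V K) :=
  Ideal.span (Set.range (X : V → MvPolynomial V K))

/-- depth of `S/I` over `S = K[x_v]`: the supremum of lengths of regular sequences on `S/I`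
consisting of elements of the graded maximal ideal. -/
noncomputable def depthQuot {K : Type*} [Field K] {V : Type*} (I : Ideal (MvPolynomial V K)) : ℕ :=
  sSup {n : ℕ | ∃ rs : List (MvPolynomial V K), rs.length = n ∧
    (∀ r ∈ rs, r ∈ maxIdeal K V) ∧
    RingTheory.Sequence.IsRegular (MvPolynomial V K ⧸ I) rs}

/-- The Stanley space `u·K[Z]` inside `S/I`, as a `K`-subspace. -/
noncomputable def stanleySpace {K : Type*} [Field K] {V : Type*}
    (I : Ideal (MvPolynomial V K)) (u : V →₀ ℕ) (Z : Finset V) :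
    Submodule K (MvPolynomial V K ⧸ I) :=
  Submodule.span K
    {x | ∃ a : V →₀ ℕ, a.support ⊆ Z ∧ x = Ideal.Quotient.mk I (monomial (u + a) (1 : K))}

/-- A Stanley decomposition of `S/I`: a finite family of Stanley spaces `u_j K[Z_j]`,
each of which is a free `K[Z_j]`-module (expressed by linear independence of the monomial
spanning set), whose internal direct sum is all of `S/I`. -/
structure StanleyDecomposition {K : Type*} [Field K] {V : Type*}
    (I : Ideal (MvPolynomial V K)) : Type _ where
  m : ℕ
  u : Fin m → (V →₀ ℕ)
  Z : Fin m → Finset V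
  free : ∀ j : Fin m, LinearIndependent K
    (fun a : {a : V →₀ ℕ // a.support ⊆ Z j} =>
      Ideal.Quotient.mk I (monomial (u j + (a : V →₀ ℕ)) (1 : K)))
  internal : DirectSum.IsInternal (fun j : Fin m => stanleySpace I (u j) (Z j))

/-- The Stanley depth of `S/I`. -/
noncomputable def sdepthQuot {K : Type*} [Field K] {V : Type*}
    (I : Ideal (MvPolynomial V K)) : ℕ :=
  sSup {n : ℕ | ∃ D : StanleyDecomposition I, ∀ j, n ≤ (D.Z j).card}

/-- `pdimLE R n M`: the `R`-module `M` has projective dimension at most `n`,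
i.e. it admits a projective resolution of length `n`. -/
def pdimLE (R : Type*) [CommRing R] :
    (n : ℕ) → (M : Type*) → [AddCommGroup M] → [Module R M] → Prop
  | 0, M, _, _ => Module.Projective R M
  | (n+1), M, _, _ => ∃ (P : Type _) (_ : AddCommGroup P) (_ : Module R P)
      (f : P →ₗ[R] M), Module.Projective R P ∧ Function.Surjective f ∧
        pdimLE R n (LinearMap.ker f)

/-- The projective dimension of `S/I` over `S`: the length of a minimal (projective/free)
resolution, i.e. the least `n` such that `S/I` has a projective resolution of length `n`. -/
noncomputable def pdimQuot {K : Type*} [Field K] {V : Type*}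
    (I : Ideal (MvPolynomial V K)) : ℕ :=
  sInf {n : ℕ | pdimLE (MvPolynomial V K) n (MvPolynomial V K ⧸ I)}

/-- The ladder graph `A n` on `2n` vertices: `inl i = x_{i+1}`, `inr i = y_{i+1}`. -/
def graphA (n : ℕ) : SimpleGraph (Fin n ⊕ Fin n) :=
  SimpleGraph.fromRel (fun a b =>
    match a, b with
    | .inl i, .inl j => (i : ℕ) + 1 = j
    | .inr i, .inr j => (i : ℕ) + 1 = j
    | .inl i, .inr j => (i : ℕ) = (j : ℕ)
    | .inr _, .inl _ => False)

/-- The graph `B n`: the ladder `A n` with one extra vertex `y_{n+1}` and edge `{y_n, y_{n+1}}`.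
Here `inl i = x_{i+1}` (`i < n`) and `inr i = y_{i+1}` (`i < n+1`). -/
def graphB (n : ℕ) : SimpleGraph (Fin n ⊕ Fin (n+1)) :=
  SimpleGraph.fromRel (fun a b =>
    match a, b with
    | .inl i, .inl j => (i : ℕ) + 1 = j
    | .inr i, .inr j => (i : ℕ) + 1 = j
    | .inl i, .inr j => (i : ℕ) = (j : ℕ)
    | .inr _, .inl _ => False)

/-- The graph `C n`: the ladder `A n` with two extra vertices `y_{n+1}, y_{n+2}` and extra
edges `{y_n, y_{n+1}}` and `{y_1, y_{n+2}}`. Here `inl i = x_{i+1}` (`i < n`) and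
`inr i = y_{i+1}` (`i < n+2`). -/
def graphC (n : ℕ) : SimpleGraph (Fin n ⊕ Fin (n+2)) :=
  SimpleGraph.fromRel (fun a b =>
    match a, b with
    | .inl i, .inl j => (i : ℕ) + 1 = j
    | .inr i, .inr j => ((i : ℕ) + 1 = j ∧ (j : ℕ) ≤ n) ∨ ((i : ℕ) = 0 ∧ (j : ℕ) = n + 1)
    | .inl i, .inr j => (i : ℕ) = (j : ℕ)
    | .inr _, .inl _ => False)

/-- The graph `D n`: the ladder `A n` with two extra vertices `x_{n+1}, y_{n+1}` and extra
edges `{y_n, y_{n+1}}` and `{x_1, x_{n+1}}`. Here `inl i = x_{i+1}` and `inr i = y_{i+1}`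
(`i < n+1`). -/
def graphD (n : ℕ) : SimpleGraph (Fin (n+1) ⊕ Fin (n+1)) :=
  SimpleGraph.fromRel (fun a b =>
    match a, b with
    | .inl i, .inl j => ((i : ℕ) + 1 = j ∧ (j : ℕ) ≤ n - 1) ∨ ((i : ℕ) = 0 ∧ (j : ℕ) = n)
    | .inr i, .inr j => (i : ℕ) + 1 = j
    | .inl i, .inr j => (i : ℕ) = (j : ℕ) ∧ (i : ℕ) ≤ n - 1
    | .inr _, .inl _ => False)

/-- The circulant graph `C_q(s)` on vertex set `{x_1, …, x_q}` (realized as `Fin q`):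
`x_i` and `x_j` are adjacent iff `|i - j| ∈ s` or `q - |i - j| ∈ s`. -/
def circulantGraph (q : ℕ) (s : Set ℕ) : SimpleGraph (Fin q) :=
  SimpleGraph.fromRel (fun i j =>
    ((i : ℤ) - (j : ℤ)).natAbs ∈ s ∨ q - ((i : ℤ) - (j : ℤ)).natAbs ∈ s)



section Homological

open CategoryTheory CategoryTheory.Abelian

universe u

variable {R : Type u} [CommRing R]

lemma pdimLE_iff (n : ℕ) : ∀ (M : Type u) [AddCommGroup M] [Module R M],
    pdimLE R n M ↔ HasProjectiveDimensionLT (ModuleCat.of R M) (n + 1) := by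
  induction n with
  | zero =>
    intro M _ _
    rw [zero_add, ← projective_iff_hasProjectiveDimensionLT_one, ← IsProjective.iff_projective]
    rfl
  | succ n ih =>
    intro M _ _
    constructor
    · rintro ⟨P, _, _, f, hP, hf, hk⟩
      have hS := LinearMap.shortExact_shortComplexKer hf
      have hP' : Projective (ModuleCat.of R P) := (IsProjective.iff_projective P).1 hP
      exact (hS.hasProjectiveDimensionLT_X₃_iff n hP').2 ((ih _).1 hk)
    · intro h
      refine ⟨M →₀ R, inferInstance, inferInstance, Finsupp.linearCombination R id,
        inferInstance, Finsupp.linearCombination_id_surjective R M, ?_⟩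
      have hS := LinearMap.shortExact_shortComplexKer
        (Finsupp.linearCombination_id_surjective R M)
      have hP' : Projective (ModuleCat.of R (M →₀ R)) :=
        (IsProjective.iff_projective (M →₀ R)).1 inferInstance
      exact (ih _).2 ((hS.hasProjectiveDimensionLT_X₃_iff n hP').1 h)

/-- multiplication by `x` as a map `R/L → R/J`. -/
noncomputable def mulQ (x : R) (J J' : Ideal R) (h : ∀ p, x * p ∈ J ↔ p ∈ J') :
    (R ⧸ J') →ₗ[R] (R ⧸ J) :=
  Submodule.mapQ J' J (LinearMap.mulLeft R x) (fun p hp => (h p).2 hp)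

/-- the projection `R/J → R/(J+(x))`. -/
noncomputable def projQ (x : R) (J : Ideal R) :
    (R ⧸ J) →ₗ[R] (R ⧸ (J ⊔ Ideal.span {x})) :=
  Submodule.mapQ J (J ⊔ Ideal.span {x}) LinearMap.id (fun _ hp => Ideal.mem_sup_left hp)

lemma mulQ_mk (x : R) (J J' : Ideal R) (h : ∀ p, x * p ∈ J ↔ p ∈ J') (p : R) :
    mulQ x J J' h (Submodule.Quotient.mk p) = Submodule.Quotient.mk (x * p) := rfl

lemma mulQ_injective (x : R) (J J' : Ideal R) (h : ∀ p, x * p ∈ J ↔ p ∈ J') :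
    Function.Injective (mulQ x J J' h) := by
  rw [← LinearMap.ker_eq_bot, LinearMap.ker_eq_bot']
  intro m hm
  obtain ⟨p, rfl⟩ := Submodule.Quotient.mk_surjective _ m
  rw [mulQ_mk, Submodule.Quotient.mk_eq_zero] at hm
  rw [Submodule.Quotient.mk_eq_zero]
  exact (h p).1 hm

lemma projQ_surjective (x : R) (J : Ideal R) : Function.Surjective (projQ x J) := by
  intro m
  obtain ⟨p, rfl⟩ := Submodule.Quotient.mk_surjective _ m
  exact ⟨Submodule.Quotient.mk p, rfl⟩

lemma exact_mulQ_projQ (x : R) (J J' : Ideal R) (h : ∀ p, x * p ∈ J ↔ p ∈ J') :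
    Function.Exact (mulQ x J J' h) (projQ x J) := by
  intro m
  obtain ⟨p, rfl⟩ := Submodule.Quotient.mk_surjective _ m
  rw [projQ, Submodule.mapQ_apply, Submodule.Quotient.mk_eq_zero]
  constructor
  · intro hp
    rw [LinearMap.id_apply, Submodule.mem_sup] at hp
    obtain ⟨a, ha, b, hb, hab⟩ := hp
    obtain ⟨c, rfl⟩ := Ideal.mem_span_singleton'.1 hb
    refine ⟨Submodule.Quotient.mk c, ?_⟩
    rw [mulQ_mk, Submodule.Quotient.eq]
    have : x * c - p = -a := by
      rw [← hab]; ring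
    rw [this]
    exact J.neg_mem ha
  · rintro ⟨m, hm⟩
    obtain ⟨c, rfl⟩ := Submodule.Quotient.mk_surjective _ m
    rw [mulQ_mk, Submodule.Quotient.eq] at hm
    rw [LinearMap.id_apply]
    have : p = -(x * c - p) + c * x := by
      ring
    rw [this]
    exact Submodule.add_mem_sup (J.neg_mem hm) (Ideal.mem_span_singleton'.2 ⟨c, rfl⟩)

/-- The short complex `R/L → R/J → R/(J+(x))`. -/
noncomputable abbrev colonSC (x : R) (J J' : Ideal R) (h : ∀ p, x * p ∈ J ↔ p ∈ J') :
    ShortComplex (ModuleCat.{u} R) :=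
  ShortComplex.mk (ModuleCat.ofHom (mulQ x J J' h)) (ModuleCat.ofHom (projQ x J)) (by
    rw [← ModuleCat.ofHom_comp, (exact_mulQ_projQ x J J' h).linearMap_comp_eq_zero]; rfl)

lemma colonSC_shortExact (x : R) (J J' : Ideal R) (h : ∀ p, x * p ∈ J ↔ p ∈ J') :
    (colonSC x J J' h).ShortExact where
  exact := (ShortComplex.ShortExact.moduleCat_exact_iff_function_exact _).mpr
    (exact_mulQ_projQ x J J' h)
  mono_f := (ModuleCat.mono_iff_injective _).2 (mulQ_injective x J J' h)
  epi_g := (ModuleCat.epi_iff_surjective _).2 (projQ_surjective x J)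

/-- projective dimension of `R/J` at most `k`. -/
def Up (J : Ideal R) (k : ℕ) : Prop :=
  HasProjectiveDimensionLT (ModuleCat.of R (R ⧸ J)) (k + 1)

/-- nonvanishing of `Ext^k(R/J, N)`. -/
def LoN (N : ModuleCat.{u} R) (J : Ideal R) (k : ℕ) : Prop :=
  ∃ e : Ext (ModuleCat.of R (R ⧸ J)) N k, e ≠ 0

lemma Up.mono {J : Ideal R} {k l : ℕ} (h : Up J k) (hkl : k ≤ l) : Up J l := by
  unfold Up at *
  exact hasProjectiveDimensionLT_of_ge _ (k + 1) _ (by omega)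

lemma Up.mid {x : R} {J J' : Ideal R} (h : ∀ p, x * p ∈ J ↔ p ∈ J') {k : ℕ}
    (h1 : Up J' k) (h2 : Up (J ⊔ Ideal.span {x}) k) : Up J k :=
  (colonSC_shortExact x J J' h).hasProjectiveDimensionLT_X₂ _ h1 h2

lemma Up.reg {x : R} {J : Ideal R} (h : ∀ p, x * p ∈ J ↔ p ∈ J) {k : ℕ}
    (h1 : Up J k) : Up (J ⊔ Ideal.span {x}) (k + 1) :=
  (colonSC_shortExact x J J h).hasProjectiveDimensionLT_X₃ _ h1 (h1.mono (Nat.le_succ k))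

lemma LoN.mid {N : ModuleCat.{u} R} {x : R} (hx : x • 𝟙 N = 𝟙 N) {J J' : Ideal R}
    (h : ∀ p, x * p ∈ J ↔ p ∈ J') {k : ℕ} (h1 : LoN N J' k) : LoN N J k := by
  obtain ⟨e, he⟩ := h1
  have hz : ∀ a : Ext (ModuleCat.of R (R ⧸ (J ⊔ Ideal.span {x}))) N (1 + k), a = 0 := by
    intro a
    have h1 : x • a = a := by
      rw [Ext.smul_eq_comp_mk₀, hx, Ext.comp_mk₀_id]
    have h2 : x • (𝟙 (ModuleCat.of R (R ⧸ (J ⊔ Ideal.span {x})))) = 0 := by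
      refine ModuleCat.hom_ext (LinearMap.ext fun m => ?_)
      obtain ⟨p, rfl⟩ := Submodule.Quotient.mk_surjective _ m
      change x • (Submodule.Quotient.mk p : R ⧸ (J ⊔ Ideal.span {x})) = 0
      rw [← Submodule.Quotient.mk_smul, Submodule.Quotient.mk_eq_zero]
      exact Ideal.mem_sup_right (Ideal.mem_span_singleton'.2 ⟨p, mul_comm _ _⟩)
    rw [← h1, ← Ext.mk₀_id_comp a, ← Ext.smul_comp, ← Ext.mk₀_smul, h2, Ext.mk₀_zero,
      Ext.zero_comp]
  obtain ⟨e', he'⟩ := Ext.contravariant_sequence_exact₁ (colonSC_shortExact x J J' h) N e rfl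
    (hz _)
  refine ⟨e', ?_⟩
  rintro rfl
  rw [Ext.comp_zero] at he'
  exact he he'.symm

lemma LoN.reg {N : ModuleCat.{u} R} {x : R} (hx : x • 𝟙 N = 0) {J : Ideal R}
    (h : ∀ p, x * p ∈ J ↔ p ∈ J) {k : ℕ} (h1 : LoN N J k) :
    LoN N (J ⊔ Ideal.span {x}) (k + 1) := by
  obtain ⟨e, he⟩ := h1
  refine ⟨(colonSC_shortExact x J J h).extClass.comp e (add_comm _ _), fun h0 => he ?_⟩
  obtain ⟨e', he'⟩ := Ext.contravariant_sequence_exact₁ (colonSC_shortExact x J J h) N e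
    (add_comm _ _) h0
  have hf : (colonSC x J J h).f = x • 𝟙 (ModuleCat.of R (R ⧸ J)) := by
    refine ModuleCat.hom_ext (LinearMap.ext fun m => ?_)
    obtain ⟨p, rfl⟩ := Submodule.Quotient.mk_surjective _ m
    rfl
  rw [← he', hf, Ext.mk₀_smul, Ext.smul_comp, Ext.mk₀_id_comp, Ext.smul_eq_comp_mk₀, hx,
    Ext.mk₀_zero, Ext.comp_zero]

lemma Up.bot : Up (⊥ : Ideal R) 0 := by
  have e : (R ⧸ (⊥ : Ideal R)) ≃ₗ[R] R := Submodule.quotEquivOfEqBot ⊥ rfl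
  have : Module.Projective R (R ⧸ (⊥ : Ideal R)) := Module.Projective.of_equiv e.symm
  exact (pdimLE_iff 0 _).1 this

lemma LoN.bot {N : ModuleCat.{u} R} (hN : ∃ y : N, y ≠ 0) : LoN N (⊥ : Ideal R) 0 := by
  obtain ⟨y, hy⟩ := hN
  let f : (R ⧸ (⊥ : Ideal R)) →ₗ[R] N :=
    Submodule.liftQ ⊥ (LinearMap.toSpanSingleton R N y) bot_le
  refine ⟨Ext.mk₀ (ModuleCat.ofHom f), fun h => hy ?_⟩
  have h0 : ModuleCat.ofHom f = 0 := by
    apply Ext.homEquiv₀.symm.injective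
    simpa using h
  have h1 : f = 0 := by simpa using congrArg ModuleCat.Hom.hom h0
  have h2 : f (Submodule.Quotient.mk 1) = y := by
    change (1 : R) • y = y
    exact one_smul R y
  rw [← h2, h1]; rfl

lemma not_pdimLE_of_LoN {N : ModuleCat.{u} R} {J : Ideal R} {k m : ℕ} (h : LoN N J k)
    (hm : pdimLE R m (R ⧸ J)) : k ≤ m := by
  by_contra hlt
  obtain ⟨e, he⟩ := h
  have := (pdimLE_iff m _).1 hm
  exact he (e.eq_zero_of_hasProjectiveDimensionLT (m + 1) (by omega))

end Homological

section GraphIdeals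

open CategoryTheory

universe u

variable {K : Type u} [Field K] {V : Type} [DecidableEq V]

/-- The edge ideal together with the variables of `W`. -/
noncomputable def killIdeal (K : Type u) [Field K] (G : SimpleGraph V) (W : Finset V) :
    Ideal (MvPolynomial V K) :=
  edgeIdeal K G ⊔ Ideal.span (X '' (W : Set V))

/-- An exponent vector whose monomial lies in `killIdeal`. -/
def BadExp (G : SimpleGraph V) (W : Finset V) (m : V →₀ ℕ) : Prop :=
  (∃ i j, G.Adj i j ∧ m i ≠ 0 ∧ m j ≠ 0) ∨ ∃ w ∈ W, m w ≠ 0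

lemma mem_killIdeal {G : SimpleGraph V} {W : Finset V} {p : MvPolynomial V K} :
    p ∈ killIdeal K G W ↔ ∀ m ∈ p.support, BadExp G W m := by
  have key : killIdeal K G W = Ideal.span ((fun s => monomial s (1 : K)) ''
      ({s | ∃ i j, G.Adj i j ∧ s = Finsupp.single i 1 + Finsupp.single j 1} ∪
        (fun w => Finsupp.single w 1) '' (W : Set V))) := by
    rw [killIdeal, edgeIdeal, ← Ideal.span_union, Set.image_union, Set.image_image]
    congr 2
    ext q
    constructor
    · rintro ⟨i, j, hij, rfl⟩
      exact ⟨_, ⟨i, j, hij, rfl⟩, by simp [X, monomial_mul]⟩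
    · rintro ⟨_, ⟨i, j, hij, rfl⟩, rfl⟩
      exact ⟨i, j, hij, by simp [X, monomial_mul]⟩
  rw [key, mem_ideal_span_monomial_image]
  refine forall₂_congr fun m _ => ?_
  constructor
  · rintro ⟨s, ⟨i, j, hij, rfl⟩ | ⟨w, hw, rfl⟩, hs⟩
    · refine Or.inl ⟨i, j, hij, ?_, ?_⟩
      · have := hs i
        simp at this
        omega
      · have := hs j
        simp at this
        omega
    · refine Or.inr ⟨w, hw, ?_⟩
      have := hs w
      simp at this
      omega
  · rintro (⟨i, j, hij, hi, hj⟩ | ⟨w, hw, hm⟩)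
    · refine ⟨_, Or.inl ⟨i, j, hij, rfl⟩, ?_⟩
      intro v
      have hne := hij.ne
      simp only [Finsupp.add_apply, Finsupp.single_apply]
      split_ifs with h1 h2 h2
      · exact absurd (h1.trans h2.symm) hne
      · subst h1; omega
      · subst h2; omega
      · omega
    · refine ⟨_, Or.inr ⟨w, hw, rfl⟩, ?_⟩
      simpa using Nat.one_le_iff_ne_zero.2 hm

lemma killIdeal_insert (G : SimpleGraph V) (W : Finset V) (x : V) :
    killIdeal K G (insert x W) = killIdeal K G W ⊔ Ideal.span {X x} := by
  rw [killIdeal, killIdeal, Finset.coe_insert, Set.image_insert_eq, Ideal.span_insert,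
    sup_assoc, sup_comm (Ideal.span {X x})]

lemma killIdeal_colon {G : SimpleGraph V} {W W' : Finset V} {x : V} (hx : x ∉ W)
    (hW' : ∀ v, v ∈ W' ↔ v ∈ W ∨ G.Adj x v) (p : MvPolynomial V K) :
    X x * p ∈ killIdeal K G W ↔ p ∈ killIdeal K G W' := by
  rw [mem_killIdeal, mem_killIdeal, support_X_mul]
  simp only [Finset.mem_map, forall_exists_index, and_imp, forall_apply_eq_imp_iff₂]
  refine forall₂_congr fun m _ => ?_
  have e : ∀ v, (addLeftEmbedding (Finsupp.single x 1)) m v ≠ 0 ↔ (v = x ∨ m v ≠ 0) := by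
    intro v
    simp only [addLeftEmbedding_apply, Finsupp.add_apply, Finsupp.single_apply]
    by_cases h : x = v
    · simp [h]
    · simp [h, Ne.symm h]
  unfold BadExp
  simp only [e, hW']
  constructor
  · rintro (⟨i, j, hij, hi, hj⟩ | ⟨w, hw, hm⟩)
    · rcases hi with rfl | hi
      · rcases hj with rfl | hj
        · exact absurd hij (G.loopless.irrefl _)
        · exact Or.inr ⟨j, Or.inr hij, hj⟩
      · rcases hj with rfl | hj
        · exact Or.inr ⟨i, Or.inr hij.symm, hi⟩
        · exact Or.inl ⟨i, j, hij, hi, hj⟩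
    · rcases hm with rfl | hm
      · exact absurd hw hx
      · exact Or.inr ⟨w, Or.inl hw, hm⟩
  · rintro (⟨i, j, hij, hi, hj⟩ | ⟨w, hw | hw, hm⟩)
    · exact Or.inl ⟨i, j, hij, Or.inr hi, Or.inr hj⟩
    · exact Or.inr ⟨w, hw, Or.inr hm⟩
    · exact Or.inl ⟨x, w, hw, Or.inl rfl, Or.inr hm⟩

/-- The one-dimensional module at the point `a`. -/
def PtMod (_a : V → K) : Type u := K

noncomputable instance (a : V → K) : AddCommGroup (PtMod a) := inferInstanceAs (AddCommGroup K)

noncomputable instance (a : V → K) : Module (MvPolynomial V K) (PtMod a) :=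
  Module.compHom K (eval a)

lemma ptMod_smul (a : V → K) (v : V) (y : PtMod a) :
    (X v : MvPolynomial V K) • y = ((a v * (show K from y) : K) : PtMod a) := by
  change (eval a (X v)) * (show K from y) = _
  rw [eval_X]

lemma ptMod_one {a : V → K} {v : V} (h : a v = 1) :
    (X v : MvPolynomial V K) • 𝟙 (ModuleCat.of (MvPolynomial V K) (PtMod a)) = 𝟙 _ := by
  refine ModuleCat.hom_ext (LinearMap.ext fun y => ?_)
  change (X v : MvPolynomial V K) • (y : PtMod a) = y
  rw [ptMod_smul, h]
  exact one_mul (show K from y)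

lemma ptMod_zero {a : V → K} {v : V} (h : a v = 0) :
    (X v : MvPolynomial V K) • 𝟙 (ModuleCat.of (MvPolynomial V K) (PtMod a)) = 0 := by
  refine ModuleCat.hom_ext (LinearMap.ext fun y => ?_)
  change (X v : MvPolynomial V K) • (y : PtMod a) = 0
  rw [ptMod_smul, h]
  exact zero_mul (show K from y)

/-- certificate that `pdim S/(I(G) + (W))` is exactly `k`. -/
def PD (K : Type u) [Field K] (G : SimpleGraph V) (W : Finset V) (k : ℕ) : Prop :=
  Up (killIdeal K G W) k ∧ ∃ a : V → K, (∀ w ∈ W, a w = 0) ∧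
    (∀ w, w ∉ W → (∀ v, G.Adj w v → v ∈ W) → a w = 1) ∧
    LoN (ModuleCat.of (MvPolynomial V K) (PtMod a)) (killIdeal K G W) k

lemma killIdeal_bot (W : Finset V) (a : V → K) (ha : ∀ w ∈ W, a w = 0) :
    Up (killIdeal K (⊥ : SimpleGraph V) W) W.card ∧
    LoN (ModuleCat.of (MvPolynomial V K) (PtMod a)) (killIdeal K (⊥ : SimpleGraph V) W)
      W.card := by
  induction W using Finset.induction_on with
  | empty =>
    have h : killIdeal K (⊥ : SimpleGraph V) ∅ = ⊥ := by
      simp [killIdeal, edgeIdeal]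
    rw [h]
    exact ⟨Up.bot, LoN.bot ⟨(1 : K), one_ne_zero (α := K)⟩⟩
  | insert x W hx ih =>
    obtain ⟨h1, h2⟩ := ih fun w hw => ha w (Finset.mem_insert_of_mem hw)
    rw [killIdeal_insert, Finset.card_insert_of_notMem hx]
    have hc : ∀ p, X x * p ∈ killIdeal K (⊥ : SimpleGraph V) W ↔
        p ∈ killIdeal K (⊥ : SimpleGraph V) W := killIdeal_colon hx (by simp)
    exact ⟨h1.reg hc, h2.reg (ptMod_zero (ha x (Finset.mem_insert_self x W))) hc⟩

lemma PD.cover {G : SimpleGraph V} {W : Finset V}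
    (hW : ∀ i j, G.Adj i j → i ∈ W ∨ j ∈ W) : PD K G W W.card := by
  have h : killIdeal K G W = killIdeal K ⊥ W := by
    ext p
    rw [mem_killIdeal, mem_killIdeal]
    refine forall₂_congr fun m _ => ?_
    unfold BadExp
    constructor
    · rintro (⟨i, j, hij, hi, hj⟩ | h)
      · rcases hW i j hij with h | h
        · exact Or.inr ⟨i, h, hi⟩
        · exact Or.inr ⟨j, h, hj⟩
      · exact Or.inr h
    · rintro (⟨i, j, hij, hi, hj⟩ | h)
      · exact absurd hij (by simp)
      · exact Or.inr h
  have ha : ∀ w ∈ W, (fun v => if v ∈ W then (0 : K) else 1) w = 0 := by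
    intro w hw; simp [hw]
  have := killIdeal_bot (K := K) W _ ha
  rw [PD, h]
  exact ⟨this.1, _, ha, fun w hw _ => by simp [hw], this.2⟩

lemma PD.colon {G : SimpleGraph V} {W W' : Finset V} {x : V} (hx : x ∉ W)
    (hW' : ∀ v, v ∈ W' ↔ v ∈ W ∨ G.Adj x v) {k : ℕ} (h : PD K G W' k) :
    ∃ a : V → K, (∀ w ∈ W, a w = 0) ∧
    (∀ w, w ∉ W → (∀ v, G.Adj w v → v ∈ W) → a w = 1) ∧
    LoN (ModuleCat.of (MvPolynomial V K) (PtMod a)) (killIdeal K G W) k := by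
  obtain ⟨-, a, h0, h1, h2⟩ := h
  have hax : a x = 1 := by
    refine h1 x ?_ fun v hv => (hW' v).2 (Or.inr hv)
    rw [hW']
    rintro (h | h)
    · exact hx h
    · exact G.loopless.irrefl _ h
  refine ⟨a, fun w hw => h0 w ((hW' w).2 (Or.inl hw)), fun w hw hv => ?_,
    h2.mid (ptMod_one hax) (killIdeal_colon hx hW')⟩
  refine h1 w ?_ fun v hv' => (hW' v).2 (Or.inl (hv v hv'))
  rw [hW']
  rintro (h | h)
  · exact hw h
  · exact hx (hv x h.symm)

lemma PD.leaf {G : SimpleGraph V} {W W' : Finset V} (x v : V) (hx : x ∉ W) (hv : v ∉ W)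
    (hvx : G.Adj v x) (hl : ∀ w, G.Adj v w → w ∈ W ∨ w = x)
    (hW' : ∀ v, v ∈ W' ↔ v ∈ W ∨ G.Adj x v) {k k₁ k₂ : ℕ}
    (h1 : PD K G (insert x W) k₁) (h2 : PD K G W' k₂) (hk : k = max k₁ k₂) :
    PD K G W k := by
  refine ⟨Up.mid (killIdeal_colon hx hW') (h2.1.mono (by omega)) ?_, ?_⟩
  · rw [← killIdeal_insert]
    exact h1.1.mono (by omega)
  · rcases le_total k₁ k₂ with h | h
    · rw [hk, max_eq_right h]
      exact h2.colon hx hW'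
    · rw [hk, max_eq_left h]
      refine h1.colon hv fun w => ?_
      rw [Finset.mem_insert]
      constructor
      · rintro (rfl | h)
        · exact Or.inr hvx
        · exact Or.inl h
      · rintro (h | h)
        · exact Or.inr h
        · exact (hl w h).symm

lemma PD.pdimQuot_eq {G : SimpleGraph V} {k : ℕ} (h : PD K G ∅ k) :
    pdimQuot (edgeIdeal K G) = k := by
  have h0 : killIdeal K G ∅ = edgeIdeal K G := by simp [killIdeal]
  obtain ⟨h1, a, -, -, h2⟩ := h
  rw [h0] at h1 h2
  have hmem : k ∈ {n : ℕ | pdimLE (MvPolynomial V K) n (MvPolynomial V K ⧸ edgeIdeal K G)} :=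
    (pdimLE_iff k _).2 h1
  exact le_antisymm (Nat.sInf_le hmem) (le_csInf ⟨k, hmem⟩ fun m hm => not_pdimLE_of_LoN h2 hm)

end GraphIdeals

section Ladder

universe u

variable {V : Type} [DecidableEq V]

/-- `v` is in the remaining part of the ladder: a pendant vertex `(r, j)`, the full columns
`j+1, …, n`, and the vertex in column `n+1`. -/
def InT (ro co : V → ℕ) (n r j : ℕ) (v : V) : Prop :=
  (j < co v ∧ co v ≤ n) ∨ (co v = j ∧ ro v = r) ∨ co v = n + 1

set_option maxHeartbeats 1000000 in
lemma ladder_PD (K : Type u) [Field K] (G : SimpleGraph V) (n : ℕ) (ro co : V → ℕ)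
    (hinj : ∀ u v, ro u = ro v → co u = co v → u = v)
    (hadj : ∀ u v, G.Adj u v ↔ ((ro u = ro v ∧ (co u + 1 = co v ∨ co v + 1 = co u)) ∨
      (ro u ≠ ro v ∧ co u = co v)))
    (hro : ∀ v, ro v = 0 ∨ ro v = 1)
    (hb0 : ∀ v, ro v = 0 → 1 ≤ co v ∧ co v ≤ n)
    (hb1 : ∀ v, ro v = 1 → co v ≤ n + 1)
    (hex0 : ∀ c, 1 ≤ c → c ≤ n → ∃ v, ro v = 0 ∧ co v = c)
    (hex1 : ∀ c, c ≤ n + 1 → ∃ v, ro v = 1 ∧ co v = c) (m : ℕ) :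
    ∀ (r j : ℕ) (W : Finset V), j + m = n → (r = 0 ∧ 1 ≤ j ∨ r = 1) →
      (∀ v, InT ro co n r j v → v ∉ W) →
      (∀ u v, G.Adj u v → u ∉ W → v ∉ W → InT ro co n r j u ∧ InT ro co n r j v) →
      PD K G W (W.card + (2 * m + r - 2 * ((m + 2 * r) / 4))) := by
  have hne : ∀ u v, u ≠ v → ¬ (ro u = ro v ∧ co u = co v) := fun u v h h' => h (hinj u v h'.1 h'.2)
  have hb : ∀ v, (ro v = 0 ∧ 1 ≤ co v ∧ co v ≤ n) ∨ (ro v = 1 ∧ co v ≤ n + 1) := by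
    intro v
    rcases hro v with h | h
    · exact Or.inl ⟨h, hb0 v h⟩
    · exact Or.inr ⟨h, hb1 v h⟩
  unfold InT
  induction m using Nat.strong_induction_on with
  | _ m ih =>
  intro r j W hj hr hT hE
  by_cases hm0 : m = 0
  · subst hm0
    rcases hr with ⟨rfl, hj1⟩ | rfl
    · -- no edges are left
      refine PD.cover fun u v huv => ?_
      by_contra hcon
      push Not at hcon
      have h1 := hE u v huv hcon.1 hcon.2
      have h2 := (hadj u v).1 huv
      rcases hb u with hba | hba <;> rcases hb v with hbb | hbb <;>
        rcases h2 with ⟨h2, h2' | h2'⟩ | ⟨h2, h2'⟩ <;> omega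
    · -- one edge
      obtain ⟨v, hv1, hv2⟩ := hex1 n (by omega)
      obtain ⟨x, hx1, hx2⟩ := hex1 (n + 1) (by omega)
      have hxW : x ∉ W := hT x (by omega)
      have hvW : v ∉ W := hT v (by omega)
      refine PD.leaf (W' := insert v W) x v hxW hvW ((hadj _ _).2 (by omega)) ?_ ?_
        (PD.cover (W := insert x W) ?_) (PD.cover (W := insert v W) ?_) ?_
      · intro w hw
        by_cases hwW : w ∈ W
        · exact Or.inl hwW
        · right
          have h1 := hE v w hw hvW hwW
          have h2 := (hadj v w).1 hw
          have := hb0 w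
          have := hro w
          exact hinj _ _ (by omega) (by omega)
      · intro w
        rw [Finset.mem_insert]
        constructor
        · rintro (rfl | h)
          · exact Or.inr ((hadj _ _).2 (by omega))
          · exact Or.inl h
        · rintro (h | h)
          · exact Or.inr h
          · have h2 := (hadj _ _).1 h
            have := hb0 w
            have := hb1 w
            have := hro w
            exact Or.inl (hinj _ _ (by omega) (by omega))
      · intro a b hab
        by_contra hcon
        simp only [Finset.mem_insert, not_or] at hcon
        have h1 := hE a b hab hcon.1.2 hcon.2.2
        have h2 := (hadj a b).1 hab
        have := hne _ _ hcon.1.1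
        have := hne _ _ hcon.2.1
        rcases hb a with hba | hba <;> rcases hb b with hbb | hbb <;>
          rcases h2 with ⟨h2, h2' | h2'⟩ | ⟨h2, h2'⟩ <;> omega
      · intro a b hab
        by_contra hcon
        simp only [Finset.mem_insert, not_or] at hcon
        have h1 := hE a b hab hcon.1.2 hcon.2.2
        have h2 := (hadj a b).1 hab
        have := hne _ _ hcon.1.1
        have := hne _ _ hcon.2.1
        rcases hb a with hba | hba <;> rcases hb b with hbb | hbb <;>
          rcases h2 with ⟨h2, h2' | h2'⟩ | ⟨h2, h2'⟩ <;> omega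
      · rw [Finset.card_insert_of_notMem hxW, Finset.card_insert_of_notMem hvW]
        simp
  -- at least one full column
  have hex : ∀ r' c, (r' = 0 ∨ r' = 1) → 1 ≤ c → c ≤ n → ∃ v, ro v = r' ∧ co v = c := by
    rintro r' c (rfl | rfl) h1 h2
    · exact hex0 c h1 h2
    · exact hex1 c (by omega)
  obtain ⟨v, hv1, hv2⟩ : ∃ v, ro v = r ∧ co v = j := by
    rcases hr with ⟨rfl, hj1⟩ | rfl
    · exact hex0 j hj1 (by omega)
    · exact hex1 j (by omega)
  obtain ⟨x, hx1, hx2⟩ := hex r (j + 1) (by omega) (by omega) (by omega)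
  obtain ⟨a, ha1, ha2⟩ := hex (1 - r) (j + 1) (by omega) (by omega) (by omega)
  have hxW : x ∉ W := hT x (by omega)
  have hvW : v ∉ W := hT v (by omega)
  have haW : a ∉ W := hT a (by omega)
  have hvx : G.Adj v x := (hadj _ _).2 (by omega)
  have hl : ∀ w, G.Adj v w → w ∈ W ∨ w = x := by
    intro w hw
    by_cases hwW : w ∈ W
    · exact Or.inl hwW
    · right
      have h1 := hE v w hw hvW hwW
      have h2 := (hadj v w).1 hw
      have := hb0 w
      have := hro w
      exact hinj _ _ (by omega) (by omega)
  have hva : v ≠ a := by rintro rfl; omega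
  have arith1 : ∀ c, (j < co c ∧ co c ≤ n) ∨ (co c = j ∧ ro c = r) ∨ co c = n + 1 →
      ¬ (ro c = ro x ∧ co c = co x) → ¬ (ro c = ro v ∧ co c = co v) →
      (j + 1 < co c ∧ co c ≤ n) ∨ (co c = j + 1 ∧ ro c = 1 - r) ∨ co c = n + 1 := by
    intro c h1 h2 h3
    have := hro c
    clear hT hE ih
    omega
  -- the deletion branch
  have hdel : PD K G (insert x W) ((insert x W).card +
      (2 * (m - 1) + (1 - r) - 2 * ((m - 1 + 2 * (1 - r)) / 4))) := by
    refine ih (m - 1) (by omega) (1 - r) (j + 1) (insert x W) (by omega) (by omega) ?_ ?_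
    · intro w hw
      rw [Finset.mem_insert, not_or]
      refine ⟨?_, hT w (by omega)⟩
      rintro rfl
      omega
    · have one : ∀ c d, G.Adj c d → c ∉ insert x W → d ∉ insert x W →
          (j + 1 < co c ∧ co c ≤ n) ∨ (co c = j + 1 ∧ ro c = 1 - r) ∨ co c = n + 1 := by
        intro c d hcd hc hd
        simp only [Finset.mem_insert, not_or] at hc hd
        have h1 := (hE c d hcd hc.2 hd.2).1
        have hcv : c ≠ v := by
          rintro rfl
          exact (hl d hcd).elim hd.2 hd.1
        exact arith1 c h1 (hne _ _ hc.1) (hne _ _ hcv)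
      exact fun c d hcd hc hd => ⟨one c d hcd hc hd, one d c hcd.symm hd hc⟩
  rw [Finset.card_insert_of_notMem hxW] at hdel
  by_cases hcase : r = 0 ∧ m = 1
  · obtain ⟨rfl, rfl⟩ := hcase
    have hW2 : ∀ w, w ∈ insert v (insert a W) ↔ w ∈ W ∨ G.Adj x w := by
      intro w
      simp only [Finset.mem_insert]
      constructor
      · rintro (rfl | rfl | h)
        · exact Or.inr hvx.symm
        · exact Or.inr ((hadj _ _).2 (by omega))
        · exact Or.inl h
      · rintro (h | h)
        · exact Or.inr (Or.inr h)
        · have h2 := (hadj _ _).1 h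
          have := hb0 w
          have := hro w
          by_cases hc : co w = j
          · exact Or.inl (hinj _ _ (by omega) (by omega))
          · exact Or.inr (Or.inl (hinj _ _ (by omega) (by omega)))
    refine PD.leaf x v hxW hvW hvx hl hW2 hdel (PD.cover ?_) ?_
    · have one : ∀ c d, G.Adj c d → c ∉ insert v (insert a W) → d ∉ insert v (insert a W) →
          co c = n + 1 ∧ ro c = 1 := by
        intro c d hcd hc hd
        have hcx : c ≠ x := by
          rintro rfl
          exact hd ((hW2 d).2 (Or.inr hcd))
        simp only [Finset.mem_insert, not_or] at hc hd
        have h1 := arith1 c (hE c d hcd hc.2.2 hd.2.2).1 (hne _ _ hcx) (hne _ _ hc.1)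
        have h3 := hne _ _ hc.2.1
        have h4 := hb c
        clear hT hE ih
        omega
      intro c d hcd
      by_contra hcon
      push Not at hcon
      have h1 := one c d hcd hcon.1 hcon.2
      have h2 := one d c hcd.symm hcon.2 hcon.1
      exact hcd.ne (hinj _ _ (by omega) (by omega))
    · rw [Finset.card_insert_of_notMem (by simp [hva, hvW]), Finset.card_insert_of_notMem haW]
      omega
  -- here the vertex `(r, j+2)` exists
  obtain ⟨b, hb1', hb2⟩ : ∃ b, ro b = r ∧ co b = j + 2 := by
    by_cases h : m = 1
    · have : r = 1 := by omega
      subst this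
      exact hex1 _ (by omega)
    · exact hex _ _ (by omega) (by omega) (by omega)
  have hbW : b ∉ W := hT b (by omega)
  have hab : a ≠ b := by rintro rfl; omega
  have hvb : v ≠ b := by rintro rfl; omega
  have hcard : (insert v (insert a (insert b W))).card = W.card + 3 := by
    rw [Finset.card_insert_of_notMem (by simp [hva, hvb, hvW]),
      Finset.card_insert_of_notMem (by simp [hab, haW]), Finset.card_insert_of_notMem hbW]
  have hW' : ∀ w, w ∈ insert v (insert a (insert b W)) ↔ w ∈ W ∨ G.Adj x w := by
    intro w
    simp only [Finset.mem_insert]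
    constructor
    · rintro (rfl | rfl | rfl | h)
      · exact Or.inr hvx.symm
      · exact Or.inr ((hadj _ _).2 (by omega))
      · exact Or.inr ((hadj _ _).2 (by omega))
      · exact Or.inl h
    · rintro (h | h)
      · exact Or.inr (Or.inr (Or.inr h))
      · have h2 := (hadj _ _).1 h
        have := hro w
        by_cases hc : co w = j
        · exact Or.inl (hinj _ _ (by omega) (by omega))
        · by_cases hc' : co w = j + 2
          · exact Or.inr (Or.inr (Or.inl (hinj _ _ (by omega) (by omega))))
          · exact Or.inr (Or.inl (hinj _ _ (by omega) (by omega)))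
  have one : ∀ c d, G.Adj c d → c ∉ insert v (insert a (insert b W)) →
      d ∉ insert v (insert a (insert b W)) →
      (j + 2 < co c ∧ co c ≤ n) ∨ (co c = j + 2 ∧ ro c = 1 - r) ∨
        (co c = n + 1 ∧ j + 2 < co c) := by
    intro c d hcd hc hd
    have hcx : c ≠ x := by
      rintro rfl
      exact hd ((hW' d).2 (Or.inr hcd))
    simp only [Finset.mem_insert, not_or] at hc hd
    have h1 := arith1 c (hE c d hcd hc.2.2.2 hd.2.2.2).1 (hne _ _ hcx) (hne _ _ hc.1)
    have h3 := hne _ _ hc.2.1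
    have h4 := hne _ _ hc.2.2.1
    have h5 := hro c
    clear hT hE ih
    omega
  by_cases hm1 : m = 1
  · have hr1 : r = 1 := by omega
    subst hm1 hr1
    refine PD.leaf x v hxW hvW hvx hl hW' hdel (PD.cover ?_) ?_
    · intro c d hcd
      by_contra hcon
      push Not at hcon
      have h1 := one c d hcd hcon.1 hcon.2
      have h4 := hb c
      omega
    · rw [hcard]
      omega
  · have hcol := ih (m - 2) (by omega) (1 - r) (j + 2) (insert v (insert a (insert b W)))
      (by omega) (by omega) (by
        intro w hw
        simp only [Finset.mem_insert, not_or]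
        refine ⟨?_, ?_, ?_, hT w (by omega)⟩ <;>
        · rintro rfl
          omega) (by
        intro c d hcd hc hd
        have h1 := one c d hcd hc hd
        have h2 := one d c hcd.symm hd hc
        exact ⟨by omega, by omega⟩)
    refine PD.leaf x v hxW hvW hvx hl hW' hdel hcol ?_
    rw [hcard]
    rcases hr with ⟨rfl, _⟩ | rfl <;> omega

end Ladder

section Ladder
universe u
/-- row of a vertex of `graphC n`. -/
def rowC (n : ℕ) : Fin n ⊕ Fin (n + 2) → ℕ
  | .inl _ => 0
  | .inr _ => 1

/-- column of a vertex of `graphC n`. -/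
def colC (n : ℕ) : Fin n ⊕ Fin (n + 2) → ℕ
  | .inl i => i + 1
  | .inr i => if (i : ℕ) ≤ n then i + 1 else 0

lemma graphC_PD (K : Type u) [Field K] (n : ℕ) (hn : 2 ≤ n) :
    PD K (graphC n) ∅ (2 * n + 1 - 2 * ((n + 2) / 4)) := by
  have h := ladder_PD K (graphC n) n (rowC n) (colC n) ?_ ?_ ?_ ?_ ?_ ?_ ?_ n 1 0 ∅ (by omega)
    (by omega) (by simp) ?_
  · simpa using h
  · rintro (⟨i, hi⟩ | ⟨i, hi⟩) (⟨j, hj⟩ | ⟨j, hj⟩) h1 h2 <;> simp [rowC, colC] at h1 h2 ⊢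
    · omega
    · split_ifs at h2 <;> omega
  · rintro (⟨i, hi⟩ | ⟨i, hi⟩) (⟨j, hj⟩ | ⟨j, hj⟩) <;>
      simp only [graphC, SimpleGraph.fromRel_adj, rowC, colC, ne_eq, Sum.inl.injEq, Sum.inr.injEq,
        Fin.mk.injEq, reduceCtorEq] <;> (try split_ifs) <;>
      simp only [true_and, false_and, not_true_eq_false, not_false_eq_true, or_false, false_or,
        iff_false, false_iff] <;> omega
  · rintro (i | i) <;> simp [rowC]
  · rintro (⟨i, hi⟩ | ⟨i, hi⟩) <;> simp [rowC, colC]; omega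
  · rintro (⟨i, hi⟩ | ⟨i, hi⟩) <;> simp [rowC, colC]; split_ifs <;> omega
  · intro c h1 h2
    exact ⟨.inl ⟨c - 1, by omega⟩, rfl, by simp [colC]; omega⟩
  · intro c h
    by_cases hc : c = 0
    · exact ⟨.inr ⟨n + 1, by omega⟩, rfl, by simp [colC, hc]⟩
    · refine ⟨.inr ⟨c - 1, by omega⟩, rfl, ?_⟩
      simp only [colC]
      split_ifs <;> omega
  · have key : ∀ v, InT (rowC n) (colC n) n 1 0 v := by
      rintro (⟨i, hi⟩ | ⟨i, hi⟩) <;> simp only [InT, rowC, colC]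
      · omega
      · by_cases h : i ≤ n <;> simp [h]; omega
    exact fun u v _ _ _ => ⟨key u, key v⟩

end Ladder

theorem pdim_graphC (n : ℕ) (hn : 2 ≤ n) (K : Type*) [Field K] :
    ((n % 4 = 0 ∨ n % 4 = 3) → pdimQuot (edgeIdeal K (graphC n)) = 2 * n - ⌈(n : ℚ) / 2⌉₊ + 1) ∧
    (n % 4 = 1 → pdimQuot (edgeIdeal K (graphC n)) = 2 * n - ⌈((n : ℚ) + 1) / 2⌉₊ + 2) ∧
    (n % 4 = 2 → pdimQuot (edgeIdeal K (graphC n)) = 2 * n - ⌈((n : ℚ) + 1) / 2⌉₊ + 1) := by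

  have h := (graphC_PD K n hn).pdimQuot_eq
  rw [h]
  have c1 : ∀ m : ℕ, ⌈(m : ℚ) / 2⌉₊ = (m + 1) / 2 := by
    intro m
    have h2 : m = 2 * (m / 2) + m % 2 := (Nat.div_add_mod m 2).symm
    rcases Nat.mod_two_eq_zero_or_one m with h0 | h0
    · obtain ⟨t, rfl⟩ : ∃ t, m = 2 * t := ⟨m / 2, by omega⟩
      have : ((2 * t : ℕ) : ℚ) / 2 = (t : ℚ) := by push_cast; ring
      rw [this, Nat.ceil_natCast]
      omega
    · obtain ⟨t, rfl⟩ : ∃ t, m = 2 * t + 1 := ⟨m / 2, by omega⟩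
      have : (2 * t + 1 + 1) / 2 = t + 1 := by omega
      rw [this, Nat.ceil_eq_iff (by omega)]
      constructor
      · push_cast [Nat.add_sub_cancel]
        linarith
      · push_cast
        linarith
  have c2 : ⌈((n : ℚ) + 1) / 2⌉₊ = (n + 2) / 2 := by
    have := c1 (n + 1)
    push_cast at this
    exact this
  rw [c1 n, c2]
  refine ⟨fun _ => ?_, fun _ => ?_, fun _ => ?_⟩ <;> omega
end

section
/- Let n ≥ 2, let K be a field, let D_n be the graph obtained from the ladder graph A_n by adjoining two new vertices x_{n+1}, y_{n+1} together with the edges {y_n,y_{n+1}} and {x_1,x_{n+1}}, and let S = K[V(D_n)]. Then depth(S/I(D_n)) = sdepth(S/I(D_n)) and this common value equals ⌈(n+1)/2⌉ + 1 if n ≡ 0 or 1 (mod 4), and equals ⌈(n+1)/2⌉ if n ≡ 2 or 3 (mod 4). -/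
open MvPolynomial

/-! ### Regular sequences in terms of ideals -/

/-- The list `fs` is a weakly regular sequence on `R / J`, stated with ideals. -/
def WR {R : Type*} [CommRing R] : List R → Ideal R → Prop
  | [], _ => True
  | f :: fs, J => (∀ g, f * g ∈ J → g ∈ J) ∧ WR fs (J ⊔ Ideal.span {f})

theorem mem_smul_top_quot {R : Type*} [CommRing R] (J I : Ideal R) (g : R) :
    Ideal.Quotient.mk J g ∈ (I • ⊤ : Submodule R (R ⧸ J)) ↔ g ∈ J ⊔ I := by
  have h : (I • ⊤ : Submodule R (R ⧸ J)) = Submodule.map J.mkQ I := by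
    have : (⊤ : Submodule R (R ⧸ J)) = Submodule.map J.mkQ ⊤ := by
      rw [Submodule.map_top, Submodule.range_mkQ]
    rw [this, ← Submodule.map_smul'']
    simp
  rw [h]
  have h2 : Submodule.comap J.mkQ (Submodule.map J.mkQ I) = J ⊔ I := by
    rw [Submodule.comap_map_mkQ]
  rw [← h2]
  rfl

theorem isWeaklyRegular_iff_WR_aux {R : Type*} [CommRing R] (J : Ideal R) (rs : List R) :
    RingTheory.Sequence.IsWeaklyRegular (R ⧸ J) rs ↔
      ∀ i (h : i < rs.length), ∀ g, rs[i] * g ∈ J ⊔ Ideal.ofList (rs.take i) →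
        g ∈ J ⊔ Ideal.ofList (rs.take i) := by
  rw [RingTheory.Sequence.isWeaklyRegular_iff]
  refine forall_congr' fun i => forall_congr' fun h => ?_
  rw [isSMulRegular_quotient_iff_mem_of_smul_mem]
  constructor
  · intro H g hg
    rw [← mem_smul_top_quot] at hg ⊢
    apply H
    exact hg
  · intro H x hx
    obtain ⟨g, rfl⟩ := Ideal.Quotient.mk_surjective x
    rw [mem_smul_top_quot]
    apply H
    rw [← mem_smul_top_quot]
    exact hx

theorem isWeaklyRegular_iff_WR {R : Type*} [CommRing R] (rs : List R) (J : Ideal R) :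
    RingTheory.Sequence.IsWeaklyRegular (R ⧸ J) rs ↔ WR rs J := by
  rw [isWeaklyRegular_iff_WR_aux]
  induction rs generalizing J with
  | nil => simp [WR]
  | cons r rs ih =>
    rw [WR, ← ih]
    constructor
    · intro H
      refine ⟨fun g hg => ?_, fun i h g hg => ?_⟩
      · have := H 0 (by simp) g
        simpa using this (by simpa using hg)
      · have := H (i + 1) (by simpa using h) g
        simp only [List.take_succ_cons, Ideal.ofList_cons, ← sup_assoc] at this
        exact this (by simpa using hg)
    · rintro ⟨H0, H⟩ i h g hg
      cases i with
      | zero => simpa using H0 g (by simpa using hg)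
      | succ i =>
        have := H i (by simpa using h) g
        simp only [List.take_succ_cons, Ideal.ofList_cons, ← sup_assoc] at hg ⊢
        exact this (by simpa using hg)

/-- The short exact sequence lemma. -/
theorem WR_of_colon {R : Type*} [CommRing R] (fs : List R) (v : R) (J C L : Ideal R)
    (hL : L = J ⊔ Ideal.span {v}) (hC : ∀ g, g ∈ C ↔ v * g ∈ J)
    (h1 : WR fs C) (h2 : WR fs L) : WR fs J := by
  induction fs generalizing J C L with
  | nil => trivial
  | cons f fs ih =>
    obtain ⟨h1a, h1b⟩ := h1
    obtain ⟨h2a, h2b⟩ := h2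
    have memL : ∀ g, g ∈ L → ∃ j ∈ J, ∃ g', g = j + v * g' := by
      intro g hg
      rw [hL] at hg
      obtain ⟨j, hj, y, hy, rfl⟩ := Submodule.mem_sup.1 hg
      obtain ⟨c, rfl⟩ := Ideal.mem_span_singleton'.1 hy
      exact ⟨j, hj, c, by ring⟩
    have hJL : J ≤ L := by rw [hL]; exact le_sup_left
    refine ⟨fun g hg => ?_, ?_⟩
    · obtain ⟨j, hj, g', rfl⟩ := memL g (h2a g (hJL hg))
      have : f * g' ∈ C := by
        rw [hC]
        have := J.sub_mem hg (J.mul_mem_left f hj)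
        convert this using 1; ring
      exact J.add_mem hj ((hC _).1 (h1a _ this))
    · refine ih (J ⊔ Ideal.span {f}) (C ⊔ Ideal.span {f}) (L ⊔ Ideal.span {f}) ?_ ?_ h1b h2b
      · rw [hL, sup_right_comm]
      · intro g
        constructor
        · intro hg
          obtain ⟨j, hj, y, hy, rfl⟩ := Submodule.mem_sup.1 hg
          obtain ⟨c, rfl⟩ := Ideal.mem_span_singleton'.1 hy
          rw [mul_add]
          refine Ideal.add_mem _ (Ideal.mem_sup_left ((hC _).1 hj)) (Ideal.mem_sup_right ?_)
          exact Ideal.mem_span_singleton'.2 ⟨v * c, by ring⟩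
        · intro hg
          obtain ⟨j, hj, y, hy, he⟩ := Submodule.mem_sup.1 hg
          obtain ⟨h, rfl⟩ := Ideal.mem_span_singleton'.1 hy
          have hfl : f * h ∈ L := by
            have hh : f * h = v * g - j := by rw [← he]; ring
            rw [hh]
            refine L.sub_mem ?_ (hJL hj)
            rw [hL]
            exact Ideal.mem_sup_right (Ideal.mem_span_singleton'.2 ⟨g, by ring⟩)
          obtain ⟨j', hj', h', rfl⟩ := memL h (h2a h hfl)
          have : g - f * h' ∈ C := by
            rw [hC]
            have hh := J.add_mem hj (J.mul_mem_left f hj')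
            convert hh using 1
            rw [mul_sub, ← he]; ring
          have h3 : g = (g - f * h') + h' * f := by ring
          rw [h3]
          exact Ideal.add_mem _ (Ideal.mem_sup_left this)
            (Ideal.mem_sup_right (Ideal.mem_span_singleton'.2 ⟨h', rfl⟩))

theorem WR_append {R : Type*} [CommRing R] (fs : List R) (f : R) (J : Ideal R)
    (h : WR fs J) (h2 : ∀ g, f * g ∈ J ⊔ Ideal.ofList fs → g ∈ J ⊔ Ideal.ofList fs) :
    WR (fs ++ [f]) J := by
  induction fs generalizing J with
  | nil => simpa [WR] using h2
  | cons a fs ih =>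
    refine ⟨h.1, ih _ h.2 ?_⟩
    simpa only [Ideal.ofList_cons, ← sup_assoc] using h2

section Hom

attribute [local instance] MvPolynomial.gradedAlgebra

theorem mem_of_forall_pow {K V : Type*} [Field K] (J : Ideal (MvPolynomial V K))
    (hJ : J.IsHomogeneous (homogeneousSubmodule V K)) (v : V) (g : MvPolynomial V K)
    (h : ∀ k : ℕ, ∃ j ∈ J, ∃ c, g = j + X v ^ k * c) : g ∈ J := by
  rw [mem_iff_homogeneousComponent_mem hJ]
  intro n
  obtain ⟨j, hj, c, rfl⟩ := h (n + 1)
  rw [map_add]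
  refine J.add_mem (homogeneousComponent_mem_of_mem hJ hj n) ?_
  have : homogeneousComponent n (X v ^ (n + 1) * c) = 0 := by
    ext d
    rw [coeff_homogeneousComponent, coeff_zero]
    split_ifs with hd
    · rw [X_pow_eq_monomial, coeff_monomial_mul']
      rw [if_neg]
      intro hle
      have h1 := hle v
      simp only [Finsupp.single_eq_same] at h1
      have h2 := Finsupp.le_degree v d
      omega
    · rfl
  rw [this]
  exact J.zero_mem

/-- Permutation: if `X v, fs` is regular on `S/J`, so is `fs, X v`. -/
theorem WR_perm {K V : Type*} [Field K] (fs : List (MvPolynomial V K)) (v : V)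
    (J L : Ideal (MvPolynomial V K))
    (hJ : J.IsHomogeneous (homogeneousSubmodule V K))
    (hfs : ∀ f ∈ fs, ∃ k, f.IsHomogeneous k)
    (hv : ∀ g, X v * g ∈ J → g ∈ J) (hL : L = J ⊔ Ideal.span {X v}) (h : WR fs L) :
    WR fs J ∧ ∀ g, X v * g ∈ J ⊔ Ideal.ofList fs → g ∈ J ⊔ Ideal.ofList fs := by
  induction fs generalizing J L with
  | nil => exact ⟨trivial, by simpa using hv⟩
  | cons f fs ih =>
    obtain ⟨ha, hb⟩ := h
    have memL : ∀ g, g ∈ L → ∃ j ∈ J, ∃ g', g = j + X v * g' := by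
      intro g hg
      rw [hL] at hg
      obtain ⟨j, hj, y, hy, rfl⟩ := Submodule.mem_sup.1 hg
      obtain ⟨c, rfl⟩ := Ideal.mem_span_singleton'.1 hy
      exact ⟨j, hj, c, by ring⟩
    have hJL : J ≤ L := by rw [hL]; exact le_sup_left
    have key : ∀ k : ℕ, ∀ g, f * g ∈ J → ∃ j ∈ J, ∃ c, g = j + X v ^ k * c ∧ f * c ∈ J := by
      intro k
      induction k with
      | zero => intro g hg; exact ⟨0, J.zero_mem, g, by simp, hg⟩
      | succ k ihk =>
        intro g hg
        obtain ⟨j, hj, c, rfl, hc⟩ := ihk g hg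
        obtain ⟨j', hj', c', rfl⟩ := memL c (ha c (hJL hc))
        refine ⟨j + X v ^ k * j', J.add_mem hj (J.mul_mem_left _ hj'), c', by ring, hv _ ?_⟩
        have := J.sub_mem hc (J.mul_mem_left f hj')
        convert this using 1; ring
    have hf : ∀ g, f * g ∈ J → g ∈ J := by
      intro g hg
      refine mem_of_forall_pow J hJ v g fun k => ?_
      obtain ⟨j, hj, c, h1, _⟩ := key k g hg
      exact ⟨j, hj, c, h1⟩
    have hJf : (J ⊔ Ideal.span {f}).IsHomogeneous (homogeneousSubmodule V K) := by
      refine hJ.sup (Ideal.homogeneous_span _ _ ?_)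
      intro x hx
      rw [Set.mem_singleton_iff.1 hx]
      obtain ⟨k, hk⟩ := hfs f (by simp)
      exact ⟨k, hk⟩
    have hvf : ∀ g, X v * g ∈ J ⊔ Ideal.span {f} → g ∈ J ⊔ Ideal.span {f} := by
      intro g hg
      obtain ⟨j, hj, y, hy, he⟩ := Submodule.mem_sup.1 hg
      obtain ⟨h, rfl⟩ := Ideal.mem_span_singleton'.1 hy
      have hfl : f * h ∈ L := by
        have hh : f * h = X v * g - j := by rw [← he]; ring
        rw [hh]
        refine L.sub_mem ?_ (hJL hj)
        rw [hL]
        exact Ideal.mem_sup_right (Ideal.mem_span_singleton'.2 ⟨g, by ring⟩)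
      obtain ⟨j', hj', h', rfl⟩ := memL h (ha h hfl)
      have : g - f * h' ∈ J := by
        apply hv
        have hh := J.add_mem hj (J.mul_mem_left f hj')
        convert hh using 1
        rw [mul_sub, ← he]; ring
      have h3 : g = (g - f * h') + h' * f := by ring
      rw [h3]
      exact Ideal.add_mem _ (Ideal.mem_sup_left this)
        (Ideal.mem_sup_right (Ideal.mem_span_singleton'.2 ⟨h', rfl⟩))
    obtain ⟨r1, r2⟩ := ih (J ⊔ Ideal.span {f}) (L ⊔ Ideal.span {f}) hJf
      (fun f hf => hfs f (by simp [hf])) hvf (by rw [hL, sup_right_comm]) hb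
    refine ⟨⟨hf, r1⟩, ?_⟩
    simpa only [Ideal.ofList_cons, ← sup_assoc] using r2

end Hom

/-! ### Monomial ideals of simplicial complexes -/

/-- The Stanley–Reisner type ideal spanned by the monomials whose support does not satisfy `P`. -/
noncomputable def faceIdeal (K : Type*) [Field K] {V : Type*} (P : Finset V → Prop) :
    Ideal (MvPolynomial V K) :=
  Ideal.span ((fun s => monomial s (1 : K)) '' {a : V →₀ ℕ | ¬ P a.support})

theorem mem_faceIdeal {K : Type*} [Field K] {V : Type*} {P : Finset V → Prop}
    (hP : ∀ A B, A ⊆ B → P B → P A) (f : MvPolynomial V K) :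
    f ∈ faceIdeal K P ↔ ∀ a ∈ f.support, ¬ P a.support := by
  rw [faceIdeal, mem_ideal_span_monomial_image]
  refine forall₂_congr fun a _ => ⟨?_, fun h => ⟨a, h, le_rfl⟩⟩
  rintro ⟨b, hb, hle⟩ hPa
  exact hb (hP _ _ (Finsupp.support_mono hle) hPa)

theorem support_single_add {V : Type*} [DecidableEq V] (v : V) (a : V →₀ ℕ) :
    (Finsupp.single v 1 + a).support = insert v a.support := by
  ext w
  by_cases h : v = w
  · subst h; simp
  · have : w ≠ v := fun e => h e.symm
    simp [this]

theorem mul_mem_faceIdeal {K : Type*} [Field K] {V : Type*} [DecidableEq V]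
    {P Q : Finset V → Prop}
    (hP : ∀ A B, A ⊆ B → P B → P A) (v : V) (hQ : ∀ A, Q A ↔ P (insert v A))
    (f : MvPolynomial V K) :
    f ∈ faceIdeal K Q ↔ X v * f ∈ faceIdeal K P := by
  have hQ' : ∀ A B, A ⊆ B → Q B → Q A := by
    intro A B hAB
    rw [hQ, hQ]
    exact hP _ _ (Finset.insert_subset_insert v hAB)
  rw [mem_faceIdeal hP, mem_faceIdeal hQ', support_X_mul]
  simp only [Finset.mem_map, addLeftEmbedding_apply, forall_exists_index, and_imp,
    forall_apply_eq_imp_iff₂, support_single_add, hQ]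

theorem X_mem_faceIdeal {K : Type*} [Field K] {V : Type*} {P : Finset V → Prop} (v : V)
    (h : ¬ P {v}) : X v ∈ faceIdeal K P := by
  refine Ideal.subset_span ⟨Finsupp.single v 1, ?_, rfl⟩
  simpa [Finsupp.support_single] using h

theorem sup_faceIdeal {K : Type*} [Field K] {V : Type*} {P Q : Finset V → Prop}
    (v : V) (hQ : ∀ A, Q A ↔ P A ∧ v ∉ A) :
    faceIdeal K Q = faceIdeal K P ⊔ Ideal.span {X v} := by
  apply le_antisymm
  · rw [faceIdeal, Ideal.span_le]
    rintro _ ⟨a, ha, rfl⟩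
    simp only [Set.mem_ofPred_eq, hQ, not_and, not_not] at ha
    by_cases h : P a.support
    · refine Ideal.mem_sup_right ?_
      rw [Ideal.mem_span_singleton]
      have hv := ha h
      rw [X_dvd_monomial]
      exact Or.inr (Finsupp.mem_support_iff.1 hv)
    · exact Ideal.mem_sup_left (Ideal.subset_span ⟨a, h, rfl⟩)
  · refine sup_le ?_ ?_
    · rw [faceIdeal, Ideal.span_le]
      rintro _ ⟨a, ha, rfl⟩
      refine Ideal.subset_span ⟨a, ?_, rfl⟩
      simp only [Set.mem_ofPred_eq, hQ] at ha ⊢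
      exact fun h => ha h.1
    · rw [Ideal.span_singleton_le_iff_mem]
      apply X_mem_faceIdeal
      simp [hQ]

section Base

attribute [local instance] MvPolynomial.gradedAlgebra

theorem faceIdeal_hom {K : Type*} [Field K] {V : Type*} (P : Finset V → Prop) :
    (faceIdeal K P).IsHomogeneous (homogeneousSubmodule V K) := by
  refine Ideal.homogeneous_span _ _ ?_
  rintro _ ⟨a, _, rfl⟩
  exact ⟨a.degree, isHomogeneous_monomial _ rfl⟩

/-- The list of the first `d` elementary symmetric polynomials. -/
noncomputable def eList (K : Type*) [Field K] (V : Type*) [Fintype V] (d : ℕ) :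
    List (MvPolynomial V K) :=
  (List.range d).map (fun i => esymm V K (i + 1))

theorem esymm_hom (K : Type*) [Field K] (V : Type*) [Fintype V] (d : ℕ) :
    (esymm V K d).IsHomogeneous d := by
  rw [esymm]
  refine IsHomogeneous.sum _ _ _ ?_
  intro t ht
  rw [Finset.mem_powersetCard] at ht
  have := IsHomogeneous.prod t (fun i => (X i : MvPolynomial V K)) (fun _ => 1)
    (fun i _ => isHomogeneous_X K i)
  simpa [ht.2] using this

theorem eList_hom (K : Type*) [Field K] (V : Type*) [Fintype V] (d : ℕ) :
    ∀ f ∈ eList K V d, ∃ k, f.IsHomogeneous k := by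
  intro f hf
  obtain ⟨i, _, rfl⟩ := List.mem_map.1 hf
  exact ⟨_, esymm_hom K V _⟩

theorem eList_succ (K : Type*) [Field K] (V : Type*) [Fintype V] (d : ℕ) :
    eList K V (d + 1) = eList K V d ++ [esymm V K (d + 1)] := by
  simp [eList, List.range_succ]

theorem prod_cancel {R ι : Type*} [CommRing R] (A : Ideal R) (x : ι → R) (Z : Finset ι)
    (h : ∀ v ∈ Z, ∀ g, x v * g ∈ A → g ∈ A) (g : R) (hg : (∏ v ∈ Z, x v) * g ∈ A) : g ∈ A := by
  classical
  induction Z using Finset.induction_on with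
  | empty => simpa using hg
  | insert a s ha ih =>
    apply ih (fun v hv => h v (Finset.mem_insert_of_mem hv))
    apply h a (Finset.mem_insert_self _ _)
    rwa [Finset.prod_insert ha, mul_assoc] at hg

theorem WR_base (K : Type*) [Field K] (V : Type*) [Fintype V] [DecidableEq V] (Z : Finset V)
    (d : ℕ) (hd : d ≤ Z.card) :
    WR (eList K V d) (faceIdeal K (fun A => A ⊆ Z)) := by
  induction Z using Finset.strongInduction generalizing d with
  | H Z ih =>
    have hdown : ∀ A B : Finset V, A ⊆ B → B ⊆ Z → A ⊆ Z := fun A B h1 h2 => h1.trans h2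
    have step : ∀ v ∈ Z, ∀ d, d < Z.card →
        WR (eList K V d) (faceIdeal K (fun A => A ⊆ Z)) ∧
        ∀ g, X v * g ∈ faceIdeal K (fun A => A ⊆ Z) ⊔ Ideal.ofList (eList K V d) →
          g ∈ faceIdeal K (fun A => A ⊆ Z) ⊔ Ideal.ofList (eList K V d) := by
      intro v hv d hd
      refine WR_perm (eList K V d) v _ (faceIdeal K (fun A => A ⊆ Z.erase v))
        (faceIdeal_hom _) (eList_hom K V d) ?_ ?_
        (ih (Z.erase v) (Finset.erase_ssubset hv) d ?_)
      · intro g hg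
        rwa [mul_mem_faceIdeal hdown v (Q := fun A => A ⊆ Z)]
        intro A
        simp [Finset.insert_subset_iff, hv]
      · apply sup_faceIdeal
        intro A
        exact Finset.subset_erase
      · rw [Finset.card_erase_of_mem hv]; omega
    rcases Nat.lt_or_ge d Z.card with hlt | hge
    · have : Z.Nonempty := Finset.card_pos.1 (by omega)
      obtain ⟨v, hv⟩ := this
      exact (step v hv d hlt).1
    · cases d with
      | zero => exact trivial
      | succ d =>
        have : Z.Nonempty := Finset.card_pos.1 (by omega)
        obtain ⟨v, hv⟩ := this
        rw [eList_succ]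
        refine WR_append _ _ _ (step v hv d (by omega)).1 ?_
        intro g hg
        refine prod_cancel _ (fun v => X v) Z (fun w hw => (step w hw d (by omega)).2) g ?_
        have hm : esymm V K (d + 1) - ∏ v ∈ Z, X v ∈ faceIdeal K (fun A => A ⊆ Z) := by
          have hZ : Z ∈ Finset.powersetCard (d + 1) (Finset.univ : Finset V) := by
            rw [Finset.mem_powersetCard]; exact ⟨Finset.subset_univ _, by omega⟩
          rw [esymm, ← Finset.sum_erase_add _ _ hZ, add_sub_cancel_right]
          refine Ideal.sum_mem _ ?_
          intro t ht
          rw [Finset.mem_erase, Finset.mem_powersetCard] at ht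
          have : ¬ t ⊆ Z := by
            intro hs
            exact ht.1 (Finset.eq_of_subset_of_card_le hs (by omega))
          obtain ⟨w, hw, hwZ⟩ := Finset.not_subset.1 this
          refine Ideal.mem_of_dvd _ (Finset.dvd_prod_of_mem _ hw) (X_mem_faceIdeal w ?_)
          simpa using hwZ
        have h2 := Ideal.sub_mem _ hg (Ideal.mem_sup_left (Ideal.mul_mem_right g _ hm))
        convert h2 using 1
        ring

end Base

/-! ### Elimination trees -/

/-- The set `A` is independent and contained in `W`. -/
def IndIn {V : Type*} (G : SimpleGraph V) (W A : Finset V) : Prop :=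
  A ⊆ W ∧ ∀ a ∈ A, ∀ b ∈ A, ¬ G.Adj a b

theorem IndIn.mono {V : Type*} (G : SimpleGraph V) (W : Finset V) :
    ∀ A B, A ⊆ B → IndIn G W B → IndIn G W A :=
  fun _ _ h hB => ⟨h.trans hB.1, fun a ha b hb => hB.2 a (h ha) b (h hb)⟩

open Classical in
/-- Elimination trees all of whose leaves are independent sets of size at least `d`. -/
inductive Lo {V : Type*} (G : SimpleGraph V) (d : ℕ) : Finset V → Prop
  | base (W : Finset V) (h : ∀ a ∈ W, ∀ b ∈ W, ¬ G.Adj a b) (hd : d ≤ W.card) : Lo G d W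
  | step (W : Finset V) (v : V) (hv : v ∈ W) (h1 : Lo G d (W.erase v))
      (h2 : Lo G d (W.filter (fun w => ¬ G.Adj v w))) : Lo G d W

theorem indIn_filter {V : Type*} [DecidableEq V] (G : SimpleGraph V) [DecidableRel G.Adj]
    (W : Finset V) (v : V) (hv : v ∈ W)
    (A : Finset V) : IndIn G (W.filter (fun w => ¬ G.Adj v w)) A ↔ IndIn G W (insert v A) := by
  constructor
  · rintro ⟨h1, h2⟩
    refine ⟨?_, ?_⟩
    · rw [Finset.insert_subset_iff]
      exact ⟨hv, h1.trans (Finset.filter_subset _ _)⟩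
    · intro a ha b hb
      rw [Finset.mem_insert] at ha hb
      rcases ha with rfl | ha <;> rcases hb with rfl | hb
      · exact G.loopless.irrefl _
      · exact (Finset.mem_filter.1 (h1 hb)).2
      · exact fun h => (Finset.mem_filter.1 (h1 ha)).2 h.symm
      · exact h2 a ha b hb
  · rintro ⟨h1, h2⟩
    refine ⟨?_, fun a ha b hb => h2 a (Finset.mem_insert_of_mem ha) b (Finset.mem_insert_of_mem hb)⟩
    intro a ha
    exact Finset.mem_filter.2 ⟨h1 (Finset.mem_insert_of_mem ha),
      h2 v (Finset.mem_insert_self _ _) a (Finset.mem_insert_of_mem ha)⟩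

theorem indIn_erase {V : Type*} [DecidableEq V] (G : SimpleGraph V) (W : Finset V) (v : V)
    (A : Finset V) : IndIn G (W.erase v) A ↔ IndIn G W A ∧ v ∉ A := by
  simp only [IndIn, Finset.subset_erase]
  tauto

theorem WR_of_Lo (K : Type*) [Field K] {V : Type*} [Fintype V] (G : SimpleGraph V) (d : ℕ)
    (W : Finset V) (h : Lo G d W) : WR (eList K V d) (faceIdeal K (IndIn G W)) := by
  classical
  induction h with
  | base W h hd =>
    have := WR_base K V W d hd
    convert this using 3
    rename_i A
    exact ⟨fun h => h.1, fun hA => ⟨hA, fun a ha b hb => h a (hA ha) b (hA hb)⟩⟩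
  | step W v hv _ _ ih1 ih2 =>
    refine WR_of_colon _ (X v) _ _ _ ?_ ?_ ih2 ih1
    · exact sup_faceIdeal v (indIn_erase G W v)
    · intro g
      apply mul_mem_faceIdeal (IndIn.mono G W)
      intro A
      convert indIn_filter G W v hv A

theorem edgeIdeal_eq (K : Type*) [Field K] {V : Type*} [Fintype V] (G : SimpleGraph V) :
    edgeIdeal K G = faceIdeal K (IndIn G Finset.univ) := by
  classical
  apply le_antisymm
  · rw [edgeIdeal, Ideal.span_le]
    rintro _ ⟨i, j, hij, rfl⟩
    refine Ideal.subset_span ⟨Finsupp.single i 1 + Finsupp.single j 1, ?_, ?_⟩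
    · rintro ⟨_, h⟩
      refine h i ?_ j ?_ hij
      · rw [support_single_add]; simp
      · rw [add_comm, support_single_add]; simp
    · simp [X, monomial_mul]
  · rw [faceIdeal, Ideal.span_le]
    rintro _ ⟨a, ha, rfl⟩
    simp only [Set.mem_ofPred_eq, IndIn, Finset.subset_univ, true_and, not_forall, not_not] at ha
    obtain ⟨i, hi, j, hj, hij⟩ := ha
    have hne := hij.ne
    have h1 : (X i * X j : MvPolynomial V K) ∈ edgeIdeal K G :=
      Ideal.subset_span ⟨i, j, hij, rfl⟩
    refine Ideal.mem_of_dvd _ ?_ h1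
    have h2 : (X i * X j : MvPolynomial V K) =
        monomial (Finsupp.single i 1 + Finsupp.single j 1) 1 := by
      simp [X, monomial_mul]
    rw [h2]
    simp only [monomial_dvd_monomial, one_ne_zero, false_or, dvd_refl, and_true]
    intro w
    rw [Finsupp.mem_support_iff] at hi hj
    simp only [Finsupp.add_apply, Finsupp.single_apply]
    split_ifs with h3 h4 h4
    · exact absurd (h3.trans h4.symm) hne
    · subst h3; omega
    · subst h4; omega
    · omega

theorem X_mem_maxIdeal (K : Type*) [Field K] {V : Type*} (v : V) : X v ∈ maxIdeal K V :=
  Ideal.subset_span ⟨v, rfl⟩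

theorem mem_maxIdeal (K : Type*) [Field K] {V : Type*} (f : MvPolynomial V K) :
    f ∈ maxIdeal K V ↔ constantCoeff f = 0 := by
  have : maxIdeal K V = RingHom.ker (constantCoeff : MvPolynomial V K →+* K) := by
    apply le_antisymm
    · rw [maxIdeal, Ideal.span_le]
      rintro _ ⟨v, rfl⟩
      simp
    · intro f hf
      rw [RingHom.mem_ker] at hf
      rw [maxIdeal, ← Set.image_univ, mem_ideal_span_X_image]
      intro m hm
      by_contra hcon
      push Not at hcon
      have : m = 0 := by ext i; simpa using hcon i (Set.mem_univ _)
      subst this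
      rw [mem_support_iff] at hm
      exact hm hf
  rw [this, RingHom.mem_ker]

theorem edgeIdeal_le_maxIdeal (K : Type*) [Field K] {V : Type*} (G : SimpleGraph V) :
    edgeIdeal K G ≤ maxIdeal K V := by
  rw [edgeIdeal, Ideal.span_le]
  rintro _ ⟨i, j, hij, rfl⟩
  exact Ideal.mul_mem_right _ _ (X_mem_maxIdeal K i)

theorem depth_lower (K : Type*) [Field K] {V : Type*} [Fintype V] (G : SimpleGraph V) (d : ℕ)
    (h : Lo G d Finset.univ) :
    ∃ rs : List (MvPolynomial V K), rs.length = d ∧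
    (∀ r ∈ rs, r ∈ maxIdeal K V) ∧
    RingTheory.Sequence.IsRegular (MvPolynomial V K ⧸ edgeIdeal K G) rs := by
  have hm : ∀ r ∈ eList K V d, r ∈ maxIdeal K V := by
    intro r hr
    obtain ⟨i, _, rfl⟩ := List.mem_map.1 hr
    rw [mem_maxIdeal, constantCoeff_eq]
    apply (esymm_hom K V (i + 1)).coeff_eq_zero
    simp
  refine ⟨eList K V d, by simp [eList], hm, ?_, ?_⟩
  · rw [isWeaklyRegular_iff_WR, edgeIdeal_eq]
    exact WR_of_Lo K G d _ h
  · intro htop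
    have h1 : Ideal.Quotient.mk (edgeIdeal K G) 1 ∈
        (Ideal.ofList (eList K V d) • ⊤ : Submodule (MvPolynomial V K) _) := by
      rw [← htop]; trivial
    rw [mem_smul_top_quot] at h1
    have h2 : edgeIdeal K G ⊔ Ideal.ofList (eList K V d) ≤ maxIdeal K V := by
      refine sup_le (edgeIdeal_le_maxIdeal K G) ?_
      rw [Ideal.ofList, Ideal.span_le]
      exact hm
    have h3 := h2 h1
    rw [mem_maxIdeal] at h3
    simp at h3

/-! ### Upper bound for the depth -/

theorem det_trick {R : Type*} [CommRing R] [IsNoetherianRing R] (m : Ideal R) [m.IsPrime]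
    (J A : Ideal R) (s f : R) (hs : s ∉ m) (hf : f ∈ m)
    (h : ∀ g ∈ A, ∃ j ∈ J, ∃ a ∈ A, s * g = j + f * a) :
    ∃ r, r ∉ m ∧ ∀ g ∈ A, r * g ∈ J := by
  let N : Submodule R (R ⧸ J) := Submodule.map J.mkQ A
  let φ : Module.End R N := LinearMap.lsmul R N s
  have hr : LinearMap.range φ ≤ (Ideal.span {f}) • (⊤ : Submodule R N) := by
    rintro _ ⟨⟨x, hx⟩, rfl⟩
    obtain ⟨g, hg, rfl⟩ := hx
    obtain ⟨j, hj, a, ha, he⟩ := h g hg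
    have : φ ⟨J.mkQ g, ⟨g, hg, rfl⟩⟩ = f • (⟨J.mkQ a, ⟨a, ha, rfl⟩⟩ : N) := by
      apply Subtype.ext
      change s • J.mkQ g = f • J.mkQ a
      rw [← map_smul, ← map_smul, smul_eq_mul, smul_eq_mul, he, map_add]
      have : J.mkQ j = 0 := (Submodule.Quotient.mk_eq_zero J).2 hj
      rw [this, zero_add]
    rw [this]
    exact Submodule.smul_mem_smul (Ideal.mem_span_singleton_self f) trivial
  obtain ⟨p, hp, hdeg, hc, h0⟩ :=
    LinearMap.exists_monic_and_natDegree_eq_and_coeff_mem_pow_and_aeval_eq_zero R φ _ hr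
  have hφ : φ = algebraMap R (Module.End R N) s := by ext x; rfl
  rw [hφ, Polynomial.aeval_algebraMap_apply] at h0
  refine ⟨Polynomial.aeval s p, ?_, ?_⟩
  · intro hm
    rw [Polynomial.aeval_def, Polynomial.eval₂_eq_sum_range, Finset.sum_range_succ,
      Polynomial.coeff_natDegree, hp] at hm
    have h1 : ∑ x ∈ Finset.range p.natDegree, (algebraMap R R) (p.coeff x) * s ^ x ∈ m := by
      refine m.sum_mem fun i hi => m.mul_mem_right _ ?_
      have h3 := hc i
      have h4 : (Ideal.span {f}) ^ (p.natDegree - i) ≤ m := by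
        rw [Finset.mem_range] at hi
        refine (Ideal.pow_le_self (by omega)).trans ?_
        rwa [Ideal.span_singleton_le_iff_mem]
      apply h4
      simpa [hdeg] using h3
    have h2 := (Ideal.add_mem_iff_right m h1).1 hm
    simp only [map_one, one_mul] at h2
    exact hs (Ideal.IsPrime.mem_of_pow_mem inferInstance _ h2)
  · intro g hg
    have h1 := LinearMap.congr_fun h0 (⟨J.mkQ g, ⟨g, hg, rfl⟩⟩ : N)
    have h2 := congrArg Subtype.val h1
    change (Polynomial.aeval s p) • J.mkQ g = 0 at h2
    rw [← map_smul] at h2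
    exact (Submodule.Quotient.mk_eq_zero J).1 h2

theorem next_prime {R : Type*} [CommRing R] [IsNoetherianRing R] (m : Ideal R) [m.IsPrime]
    (J P : Ideal R) (u : R) (hu : ∀ p ∈ P, p * u ∈ J) (hum : ∀ t, t * u ∈ J → t ∈ m)
    (f : R) (hf : f ∈ m) (hreg : ∀ g, f * g ∈ J → g ∈ J) :
    f ∉ P ∧ ∃ Q : Ideal R, Q.IsPrime ∧ P ≤ Q ∧ f ∈ Q ∧ ∃ u',
      (∀ q ∈ Q, q * u' ∈ J ⊔ Ideal.span {f}) ∧ ∀ t, t * u' ∈ J ⊔ Ideal.span {f} → t ∈ m := by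
  have h1m : (1 : R) ∉ m := (Ideal.ne_top_iff_one m).1 (Ideal.IsPrime.ne_top inferInstance)
  refine ⟨fun hfP => h1m (hum 1 (by simpa using hreg u (hu f hfP))), ?_⟩
  set J' := J ⊔ Ideal.span {f} with hJ'
  have stepA : ∃ g, (∀ p ∈ P, p * g ∈ J) ∧ ∀ t, t * g ∈ J' → t ∈ m := by
    by_contra hcon
    push Not at hcon
    let A : Ideal R :=
      { carrier := {g | ∀ p ∈ P, p * g ∈ J}
        add_mem' := fun {a b} ha hb p hp => by
          rw [mul_add]; exact J.add_mem (ha p hp) (hb p hp)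
        zero_mem' := fun p _ => by simp
        smul_mem' := fun c x hx p hp => by
          rw [smul_eq_mul, mul_left_comm]; exact J.mul_mem_left _ (hx p hp) }
    have hA : ∀ g, g ∈ A ↔ ∀ p ∈ P, p * g ∈ J := fun g => Iff.rfl
    obtain ⟨T, hT⟩ := (isNoetherianRing_iff_ideal_fg R).1 inferInstance A
    have : ∀ T' : Finset R, (T' : Set R) ⊆ A → ∃ s, s ∉ m ∧ ∀ g ∈ T', s * g ∈ J' := by
      classical
      intro T'
      induction T' using Finset.induction_on with
      | empty => intro _; exact ⟨1, h1m, by simp⟩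
      | insert a T' _ ih =>
        intro hsub
        obtain ⟨s, hs, hs'⟩ := ih (fun x hx => hsub (by simp at hx; simp [hx]))
        obtain ⟨t, ht, ht'⟩ := hcon a ((hA a).1 (hsub (by simp)))
        refine ⟨s * t, fun hst => ?_, ?_⟩
        · rcases Ideal.IsPrime.mem_or_mem inferInstance hst with h | h
          · exact hs h
          · exact ht' h
        · intro g hg
          rw [Finset.mem_insert] at hg
          rcases hg with rfl | hg
          · rw [mul_assoc]; exact J'.mul_mem_left _ ht
          · rw [mul_right_comm]; exact J'.mul_mem_right _ (hs' g hg)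
    obtain ⟨s, hs, hsT⟩ := this T (by rw [← hT]; exact Ideal.subset_span)
    have hsA : ∀ g ∈ A, s * g ∈ J' := by
      intro g hg
      rw [← hT] at hg
      induction hg using Submodule.span_induction with
      | mem x hx => exact hsT x hx
      | zero => simp
      | add x y _ _ hx hy => rw [mul_add]; exact J'.add_mem hx hy
      | smul a x _ hx => rw [smul_eq_mul, mul_left_comm]; exact J'.mul_mem_left _ hx
    obtain ⟨r, hr, hrA⟩ := det_trick m J A s f hs hf (by
      intro g hg
      obtain ⟨j, hj, y, hy, he⟩ := Submodule.mem_sup.1 (hsA g hg)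
      obtain ⟨c, rfl⟩ := Ideal.mem_span_singleton'.1 hy
      refine ⟨j, hj, c, ?_, by rw [← he]; ring⟩
      intro p hp
      apply hreg
      have h1 : s * (p * g) ∈ J := J.mul_mem_left _ (hg p hp)
      have h2 := J.sub_mem h1 (J.mul_mem_left p hj)
      convert h2 using 1
      rw [mul_left_comm s p g, ← he]; ring)
    exact hr (hum r (hrA u hu))
  obtain ⟨g, hgP, hgm⟩ := stepA
  -- choose a maximal annihilator
  let ann : R → Ideal R := fun x =>
    { carrier := {t | t * x ∈ J'}
      add_mem' := fun {a b} ha hb => by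
        change (a + b) * x ∈ J'
        rw [add_mul]; exact J'.add_mem ha hb
      zero_mem' := by change 0 * x ∈ J'; rw [zero_mul]; exact J'.zero_mem
      smul_mem' := fun c y hy => by
        change c * y * x ∈ J'
        rw [mul_assoc]; exact J'.mul_mem_left _ hy }
  have hann : ∀ x t, t ∈ ann x ↔ t * x ∈ J' := fun x t => Iff.rfl
  let F : Set (Ideal R) := {Q | ∃ c, Q = ann (c * g) ∧ Q ≤ m}
  have hF : F.Nonempty := ⟨ann g, 1, by simp, fun t ht => hgm t ((hann g t).1 ht)⟩
  obtain ⟨Q, ⟨c, hQ, hQm⟩, hmax⟩ := set_has_maximal_iff_noetherian.2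
    (inferInstance : IsNoetherian R R) F hF
  have hmQ : ∀ t, t ∈ Q ↔ t * (c * g) ∈ J' := by rw [hQ]; exact hann _
  have hmul : ∀ x, ann (x * (c * g)) ≤ m → ∀ t, t * (x * (c * g)) ∈ J' → t ∈ Q := by
    intro x hx t ht
    have hle : Q ≤ ann (x * (c * g)) := by
      intro y hy
      rw [hann, mul_left_comm]
      exact J'.mul_mem_left _ ((hmQ y).1 hy)
    have hmem : ann (x * (c * g)) ∈ F := ⟨x * c, by rw [mul_assoc], hx⟩
    have hnl := hmax _ hmem
    by_contra htQ
    exact hnl (lt_of_le_of_ne hle (fun e => htQ (by rw [e]; exact (hann _ _).2 ht)))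
  refine ⟨Q, ?_, ?_, ?_, c * g, fun q hq => (hmQ q).1 hq, fun t ht => hQm ((hmQ t).2 ht)⟩
  · constructor
    · intro htop
      exact h1m (hQm (by rw [htop]; trivial))
    · intro a b hab
      by_cases hle : ann (a * (c * g)) ≤ m
      · right
        apply hmul a hle
        have := (hmQ _).1 hab
        convert this using 1; ring
      · left
        obtain ⟨s, hs, hsm⟩ := SetLike.not_le_iff_exists.1 hle
        rw [hann] at hs
        apply hmul s
        · intro t ht
          rw [hann, ← mul_assoc] at ht
          have := hQm ((hmQ _).2 ht)
          exact (Ideal.IsPrime.mem_or_mem inferInstance this).resolve_right hsm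
        · convert hs using 1; ring
  · intro p hp
    rw [hmQ, mul_left_comm]
    exact J'.mul_mem_left _ (Ideal.mem_sup_left (hgP p hp))
  · rw [hmQ]
    exact Ideal.mem_sup_right (Ideal.mem_span_singleton'.2 ⟨c * g, by ring⟩)

theorem length_le_dim {R : Type*} [CommRing R] [IsNoetherianRing R] (m : Ideal R) [m.IsPrime]
    (rs : List R) (J P : Ideal R) (hP : P.IsPrime) (u : R) (hu : ∀ p ∈ P, p * u ∈ J)
    (hum : ∀ t, t * u ∈ J → t ∈ m)
    (hrs : ∀ r ∈ rs, r ∈ m) (h : WR rs J) :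
    ((rs.length : ℕ) : WithBot ℕ∞) ≤ ringKrullDim (R ⧸ P) := by
  induction rs generalizing J P u with
  | nil =>
    simp only [List.length_nil, Nat.cast_zero]
    exact ringKrullDim_nonneg_of_nontrivial
  | cons f fs ih =>
    obtain ⟨hfP, Q, hQ, hPQ, hfQ, u', h1, h2⟩ :=
      next_prime m J P u hu hum f (hrs f (by simp)) h.1
    have h3 := ih _ Q hQ u' h1 h2 (fun r hr => hrs r (by simp [hr])) h.2
    have h4 : ringKrullDim (R ⧸ Q) + 1 ≤ ringKrullDim (R ⧸ P) := by
      refine ringKrullDim_succ_le_of_surjective (Ideal.Quotient.factor hPQ)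
        (Ideal.Quotient.factor_surjective hPQ) (r := Ideal.Quotient.mk P f) ?_ ?_
      · rw [mem_nonZeroDivisors_iff_ne_zero, Ne, Ideal.Quotient.eq_zero_iff_mem]
        exact hfP
      · rw [Ideal.Quotient.factor_mk, Ideal.Quotient.eq_zero_iff_mem]
        exact hfQ
    refine le_trans ?_ h4
    rw [List.length_cons, Nat.cast_add, Nat.cast_one]
    gcongr

/-- The maximal independent sets `F` of the graph. -/
def MaxInd {V : Type*} (G : SimpleGraph V) (F : Finset V) : Prop :=
  (∀ a ∈ F, ∀ b ∈ F, ¬ G.Adj a b) ∧ ∀ v, v ∉ F → ∃ a ∈ F, G.Adj v a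

theorem depth_upper (K : Type*) [Field K] {V : Type*} [Fintype V] (G : SimpleGraph V)
    (F : Finset V) (hF : MaxInd G F) (rs : List (MvPolynomial V K))
    (hrs : ∀ r ∈ rs, r ∈ maxIdeal K V)
    (h : RingTheory.Sequence.IsRegular (MvPolynomial V K ⧸ edgeIdeal K G) rs) :
    rs.length ≤ F.card := by
  classical
  have hW := (isWeaklyRegular_iff_WR _ _).1 h.toIsWeaklyRegular
  let ψ : MvPolynomial V K →ₐ[K] MvPolynomial F K :=
    aeval (fun v => if hv : v ∈ F then X ⟨v, hv⟩ else 0)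
  have hψ : Function.Surjective ψ := by
    intro q
    refine ⟨rename (fun v : F => (v : V)) q, ?_⟩
    simp only [ψ, aeval_rename]
    have : ((fun v => if hv : v ∈ F then (X ⟨v, hv⟩ : MvPolynomial F K) else 0) ∘
      fun v : F => (v : V)) = X := by
      ext1 v; simp
    rw [this]; simp
  let P : Ideal (MvPolynomial V K) := RingHom.ker ψ.toRingHom
  have hP : P.IsPrime := RingHom.ker_isPrime _
  have hm : (maxIdeal K V).IsPrime := by
    have : maxIdeal K V = RingHom.ker (constantCoeff : MvPolynomial V K →+* K) := by
      ext f; rw [mem_maxIdeal, RingHom.mem_ker]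
    rw [this]; exact RingHom.ker_isPrime _
  have hdim : ringKrullDim (MvPolynomial V K ⧸ P) ≤ F.card := by
    have e : (MvPolynomial V K ⧸ P) ≃+* MvPolynomial F K :=
      RingHom.quotientKerEquivOfSurjective (f := ψ.toRingHom) hψ
    rw [ringKrullDim_eq_of_ringEquiv e, MvPolynomial.ringKrullDim_of_isNoetherianRing]
    simp
  -- the ideal `P` is generated by the variables outside `F`
  let aF : V →₀ ℕ := Finsupp.indicator F (fun _ _ => 1)
  have haF : aF.support = F := by
    ext v; simp [aF, Finsupp.indicator_apply]
  have hsup : ∀ a : V →₀ ℕ, (a + aF).support = a.support ∪ F := by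
    intro a
    ext v
    by_cases hv : v ∈ F <;> simp [aF, Finsupp.indicator_apply, hv]
  have key : ∀ p : MvPolynomial V K, p * monomial aF 1 ∈ edgeIdeal K G ↔
      ∀ a ∈ p.support, ¬ a.support ⊆ F := by
    intro p
    rw [edgeIdeal_eq, mem_faceIdeal (IndIn.mono G _)]
    constructor
    · intro H a ha hsub
      refine H (a + aF) ?_ ?_
      · rw [mem_support_iff, coeff_mul_monomial, mul_one]
        exact mem_support_iff.1 ha
      · rw [hsup, Finset.union_eq_right.2 hsub]
        exact ⟨Finset.subset_univ _, hF.1⟩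
    · intro H b hb hind
      rw [mem_support_iff, coeff_mul_monomial'] at hb
      split_ifs at hb with hle
      · rw [mul_one] at hb
        obtain ⟨v, hv, hvF⟩ := Finset.not_subset.1 (H _ (mem_support_iff.2 hb))
        obtain ⟨w, hw, hvw⟩ := hF.2 v hvF
        have hb2 : b = (b - aF) + aF := (tsub_add_cancel_of_le hle).symm
        rw [hb2, hsup] at hind
        exact hind.2 v (Finset.mem_union_left _ hv) w (Finset.mem_union_right _ hw) hvw
      · exact hb rfl
  have hPmem : ∀ p ∈ P, ∀ a ∈ p.support, ¬ a.support ⊆ F := by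
    intro p hp
    rw [← mem_faceIdeal (P := fun A => A ⊆ F) (fun A B h1 h2 => h1.trans h2)]
    let I := faceIdeal K (fun A : Finset V => A ⊆ F)
    have hcomp : Ideal.Quotient.mkₐ K I =
        ((Ideal.Quotient.mkₐ K I).comp (rename (fun v : F => (v : V)))).comp ψ := by
      apply MvPolynomial.algHom_ext
      intro v
      by_cases hv : v ∈ F
      · simp [ψ, hv]
      · have hX : X v ∈ I := X_mem_faceIdeal v (by simpa using hv)
        simpa [ψ, hv, Ideal.Quotient.eq_zero_iff_mem] using hX
    have h1 := DFunLike.congr_fun hcomp p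
    have h2 : ψ p = 0 := hp
    simp only [AlgHom.comp_apply, h2, map_zero] at h1
    exact Ideal.Quotient.eq_zero_iff_mem.1 h1
  have := length_le_dim (maxIdeal K V) rs (edgeIdeal K G) P hP (monomial aF 1)
    (fun p hp => (key p).2 (hPmem p hp)) ?_ hrs hW
  · exact_mod_cast this.trans hdim
  · intro t ht
    rw [mem_maxIdeal]
    by_contra h0
    rw [key] at ht
    refine ht 0 ?_ (by simp)
    rwa [mem_support_iff, ← constantCoeff_eq]

/-! ### Stanley depth -/

theorem mk_monomial_eq_zero (K : Type*) [Field K] {V : Type*} [Fintype V] (G : SimpleGraph V)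
    (a : V →₀ ℕ) (ha : ¬ IndIn G Finset.univ a.support) :
    Ideal.Quotient.mk (edgeIdeal K G) (monomial a (1 : K)) = 0 := by
  rw [Ideal.Quotient.eq_zero_iff_mem, edgeIdeal_eq]
  exact Ideal.subset_span ⟨a, ha, rfl⟩

theorem exists_coeff_functional (K : Type*) [Field K] {V : Type*} [Fintype V] (G : SimpleGraph V)
    (a : V →₀ ℕ) (ha : IndIn G Finset.univ a.support) :
    ∃ φ : (MvPolynomial V K ⧸ edgeIdeal K G) →ₗ[K] K,
      ∀ f, φ (Ideal.Quotient.mk (edgeIdeal K G) f) = coeff a f := by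
  have h : (edgeIdeal K G).restrictScalars K ≤ LinearMap.ker (lcoeff K a) := by
    intro f hf
    rw [Submodule.restrictScalars_mem, edgeIdeal_eq, mem_faceIdeal (IndIn.mono G _)] at hf
    rw [LinearMap.mem_ker, lcoeff_apply]
    by_contra hne
    exact hf a (mem_support_iff.2 hne) ha
  exact ⟨(((edgeIdeal K G).restrictScalars K).liftQ (lcoeff K a) h) ∘ₗ
    (Submodule.Quotient.restrictScalarsEquiv K (edgeIdeal K G)).symm.toLinearMap, fun f => rfl⟩

theorem linInd_monomials (K : Type*) [Field K] {V : Type*} [Fintype V] (G : SimpleGraph V) :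
    LinearIndependent K (fun a : {a : V →₀ ℕ // IndIn G Finset.univ a.support} =>
      Ideal.Quotient.mk (edgeIdeal K G) (monomial (a : V →₀ ℕ) (1 : K))) := by
  classical
  rw [linearIndependent_iff']
  intro s g hg i hi
  obtain ⟨φ, hφ⟩ := exists_coeff_functional K G i.1 i.2
  have h := congrArg φ hg
  simp only [map_sum, map_smul, hφ, coeff_monomial, map_zero, smul_eq_mul, mul_ite, mul_one,
    mul_zero, Subtype.coe_inj] at h
  simpa [hi] using h

theorem exists_part {V : Type*} (G : SimpleGraph V) (d : ℕ) (W : Finset V)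
    (h : Lo G d W) :
    ∃ Q : Finset (Finset V × Finset V),
      (∀ p ∈ Q, p.1 ⊆ p.2 ∧ IndIn G W p.2 ∧ d ≤ p.2.card) ∧
      ∀ A, IndIn G W A → ∃! p, p ∈ Q ∧ p.1 ⊆ A ∧ A ⊆ p.2 := by
  classical
  induction h with
  | base W h hd =>
    refine ⟨{(∅, W)}, ?_, ?_⟩
    · intro p hp
      rw [Finset.mem_singleton] at hp
      subst hp
      exact ⟨Finset.empty_subset _, ⟨subset_rfl, h⟩, hd⟩
    · intro A hA
      refine ⟨(∅, W), ⟨Finset.mem_singleton_self _, Finset.empty_subset _, hA.1⟩, ?_⟩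
      rintro p ⟨hp, _⟩
      exact Finset.mem_singleton.1 hp
  | step W v hv _ _ ih1 ih2 =>
    obtain ⟨Q0, h01, h02⟩ := ih1
    obtain ⟨Q1, h11, h12⟩ := ih2
    refine ⟨Q0 ∪ (Q1.filter (fun p => v ∈ p.2)).image (fun p => (insert v p.1, p.2)), ?_, ?_⟩
    · intro p hp
      rw [Finset.mem_union] at hp
      rcases hp with hp | hp
      · obtain ⟨a, b, c⟩ := h01 p hp
        exact ⟨a, ⟨b.1.trans (Finset.erase_subset _ _), b.2⟩, c⟩
      · obtain ⟨q, hq, rfl⟩ := Finset.mem_image.1 hp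
        obtain ⟨hq, hvq⟩ := Finset.mem_filter.1 hq
        obtain ⟨a, b, c⟩ := h11 q hq
        exact ⟨Finset.insert_subset hvq a, ⟨b.1.trans (Finset.filter_subset _ _), b.2⟩, c⟩
    · intro A hA
      by_cases hvA : v ∈ A
      · have hA' : IndIn G (W.filter (fun w => ¬ G.Adj v w)) A := by
          have := indIn_filter G W v hv A
          rw [Finset.insert_eq_of_mem hvA] at this
          convert this.2 hA
        obtain ⟨p, ⟨hp, hp1, hp2⟩, hu⟩ := h12 A hA'
        refine ⟨(insert v p.1, p.2), ⟨?_, Finset.insert_subset hvA hp1, hp2⟩, ?_⟩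
        · exact Finset.mem_union_right _ (Finset.mem_image.2
            ⟨p, Finset.mem_filter.2 ⟨hp, hp2 hvA⟩, rfl⟩)
        · rintro q ⟨hq, hq1, hq2⟩
          rw [Finset.mem_union] at hq
          rcases hq with hq | hq
          · exact absurd ((h01 q hq).2.1.1 (hq2 hvA)) (Finset.notMem_erase v W)
          · obtain ⟨r, hr, rfl⟩ := Finset.mem_image.1 hq
            obtain ⟨hr, hvr⟩ := Finset.mem_filter.1 hr
            rw [hu r ⟨hr, (Finset.subset_insert _ _).trans hq1, hq2⟩]
      · obtain ⟨p, ⟨hp, hp1, hp2⟩, hu⟩ := h02 A ((indIn_erase G W v A).2 ⟨hA, hvA⟩)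
        refine ⟨p, ⟨Finset.mem_union_left _ hp, hp1, hp2⟩, ?_⟩
        rintro q ⟨hq, hq1, hq2⟩
        rw [Finset.mem_union] at hq
        rcases hq with hq | hq
        · exact hu q ⟨hq, hq1, hq2⟩
        · obtain ⟨r, hr, rfl⟩ := Finset.mem_image.1 hq
          exact absurd (hq1 (Finset.mem_insert_self _ _)) hvA

/-- The exponent of the squarefree monomial with support `U`. -/
noncomputable def sqf {V : Type*} (U : Finset V) : V →₀ ℕ := Finsupp.indicator U (fun _ _ => 1)

theorem support_sqf_add {V : Type*} [DecidableEq V] (U : Finset V) (a : V →₀ ℕ) :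
    (sqf U + a).support = U ∪ a.support := by
  ext w
  by_cases h : w ∈ U <;> simp [sqf, h, Finsupp.indicator_apply]

theorem exists_sqf_add {V : Type*} [DecidableEq V] (U : Finset V) (a : V →₀ ℕ)
    (h : U ⊆ a.support) : ∃ b, a = sqf U + b := by
  refine ⟨a - sqf U, ?_⟩
  rw [add_tsub_cancel_of_le]
  intro w
  by_cases hw : w ∈ U
  · have := Finsupp.mem_support_iff.1 (h hw)
    simp [sqf, hw, Finsupp.indicator_apply]
    omega
  · simp [sqf, hw, Finsupp.indicator_apply]

theorem sdepth_lower (K : Type*) [Field K] {V : Type*} [Fintype V] (G : SimpleGraph V) (d : ℕ)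
    (h : Lo G d Finset.univ) :
    ∃ D : StanleyDecomposition (edgeIdeal K G), ∀ j, d ≤ (D.Z j).card := by
  classical
  obtain ⟨Q, hQ1, hQ2⟩ := exists_part G d _ h
  let e := Q.equivFin.symm
  have hmem : ∀ (j : Fin Q.card) (a : V →₀ ℕ), a.support ⊆ (e j).1.2 →
      IndIn G Finset.univ (sqf (e j).1.1 + a).support := by
    intro j a ha
    obtain ⟨h1, h2, _⟩ := hQ1 _ (e j).2
    rw [support_sqf_add]
    exact IndIn.mono G _ _ _ (Finset.union_subset h1 ha) h2
  let B := (fun a : {a : V →₀ ℕ // IndIn G Finset.univ a.support} =>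
      Ideal.Quotient.mk (edgeIdeal K G) (monomial (a : V →₀ ℕ) (1 : K)))
  have hB : LinearIndependent K B := linInd_monomials K G
  let N : Fin Q.card → Set {a : V →₀ ℕ // IndIn G Finset.univ a.support} :=
    fun j => {a | (e j).1.1 ⊆ a.1.support ∧ a.1.support ⊆ (e j).1.2}
  have hspan : ∀ j, stanleySpace (edgeIdeal K G) (sqf (e j).1.1) (e j).1.2 =
      Submodule.span K (B '' N j) := by
    intro j
    rw [stanleySpace]
    congr 1
    ext x
    constructor
    · rintro ⟨a, ha, rfl⟩
      refine ⟨⟨_, hmem j a ha⟩, ?_, rfl⟩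
      change _ ⊆ (sqf (e j).1.1 + a).support ∧ (sqf (e j).1.1 + a).support ⊆ _
      rw [support_sqf_add]
      exact ⟨Finset.subset_union_left, Finset.union_subset (hQ1 _ (e j).2).1 ha⟩
    · rintro ⟨⟨a, ha⟩, ⟨h1, h2⟩, rfl⟩
      obtain ⟨b, rfl⟩ := exists_sqf_add _ a h1
      refine ⟨b, ?_, rfl⟩
      change (sqf (e j).1.1 + b).support ⊆ _ at h2
      rw [support_sqf_add] at h2
      exact Finset.subset_union_right.trans h2
  have hdisj : ∀ i j a, a ∈ N i → a ∈ N j → i = j := by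
    intro i j a hi hj
    obtain ⟨p, _, hu⟩ := hQ2 a.1.support a.2
    have h1 := hu _ ⟨(e i).2, hi⟩
    have h2 := hu _ ⟨(e j).2, hj⟩
    exact e.injective (Subtype.ext (h1.trans h2.symm))
  have hcov : ∀ a, ∃ i, a ∈ N i := by
    intro a
    obtain ⟨p, ⟨hp, h1⟩, _⟩ := hQ2 a.1.support a.2
    refine ⟨e.symm ⟨p, hp⟩, ?_⟩
    change (e (e.symm ⟨p, hp⟩)).1.1 ⊆ _ ∧ _ ⊆ (e (e.symm ⟨p, hp⟩)).1.2
    rw [Equiv.apply_symm_apply]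
    exact h1
  refine ⟨⟨Q.card, fun j => sqf (e j).1.1, fun j => (e j).1.2, ?_, ?_⟩,
    fun j => (hQ1 _ (e j).2).2.2⟩
  · intro j
    refine hB.comp (fun a : {a : V →₀ ℕ // a.support ⊆ (e j).1.2} =>
      (⟨_, hmem j a.1 a.2⟩ : {a : V →₀ ℕ // IndIn G Finset.univ a.support})) ?_
    intro a b hab
    exact Subtype.ext (add_left_cancel (Subtype.ext_iff.1 hab))
  · rw [DirectSum.isInternal_submodule_iff_iSupIndep_and_iSup_eq_top]
    simp only [hspan]
    constructor
    · intro i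
      simp only [← Submodule.span_iUnion, ← Set.image_iUnion]
      apply hB.disjoint_span_image
      rw [Set.disjoint_left]
      intro a hi hj
      simp only [Set.mem_iUnion] at hj
      obtain ⟨j, hne, hj⟩ := hj
      exact hne (hdisj j i a hj hi)
    · rw [← Submodule.span_iUnion, ← Set.image_iUnion, eq_top_iff]
      rintro x -
      obtain ⟨f, rfl⟩ := Ideal.Quotient.mk_surjective x
      rw [f.as_sum, map_sum]
      refine Submodule.sum_mem _ fun a _ => ?_
      have : (monomial a (coeff a f) : MvPolynomial V K) = (coeff a f) • monomial a 1 := by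
        rw [smul_monomial, smul_eq_mul, mul_one]
      rw [this]
      have h3 : Ideal.Quotient.mk (edgeIdeal K G) ((coeff a f) • monomial a 1) =
        (coeff a f) • Ideal.Quotient.mk (edgeIdeal K G) (monomial a 1) := rfl
      rw [h3]
      refine Submodule.smul_mem _ _ ?_
      by_cases ha : IndIn G Finset.univ a.support
      · obtain ⟨i, hi⟩ := hcov ⟨a, ha⟩
        exact Submodule.subset_span ⟨⟨a, ha⟩, Set.mem_iUnion.2 ⟨i, hi⟩, rfl⟩
      · rw [mk_monomial_eq_zero K G a ha]
        exact Submodule.zero_mem _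

theorem sdepth_upper (K : Type*) [Field K] {V : Type*} [Fintype V] (G : SimpleGraph V)
    (F : Finset V) (hF : MaxInd G F) (D : StanleyDecomposition (edgeIdeal K G)) :
    ∃ j, (D.Z j).card ≤ F.card := by
  classical
  have hs : (sqf F).support = F := by simpa using support_sqf_add F 0
  obtain ⟨φ, hφ⟩ := exists_coeff_functional K G (sqf F)
    (by rw [hs]; exact ⟨Finset.subset_univ _, hF.1⟩)
  have key : ∃ j, ∃ a : V →₀ ℕ, a.support ⊆ D.Z j ∧ D.u j + a = sqf F := by
    by_contra hcon
    push Not at hcon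
    have h1 : (⊤ : Submodule K (MvPolynomial V K ⧸ edgeIdeal K G)) ≤ LinearMap.ker φ := by
      rw [← ((DirectSum.isInternal_submodule_iff_iSupIndep_and_iSup_eq_top _).1 D.internal).2]
      refine iSup_le fun j => ?_
      rw [stanleySpace, Submodule.span_le]
      rintro _ ⟨a, ha, rfl⟩
      rw [SetLike.mem_coe, LinearMap.mem_ker, hφ, coeff_monomial, if_neg (hcon j a ha)]
    have h2 : φ (Ideal.Quotient.mk (edgeIdeal K G) (monomial (sqf F) 1)) = 0 := h1 trivial
    rw [hφ, coeff_monomial, if_pos rfl] at h2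
    exact one_ne_zero h2
  obtain ⟨j, a, ha, he⟩ := key
  refine ⟨j, Finset.card_le_card fun z hz => ?_⟩
  by_contra hzF
  have hne := (D.free j).ne_zero ⟨Finsupp.single z 1 + a, by
    rw [support_single_add]; exact Finset.insert_subset hz ha⟩
  apply hne
  apply mk_monomial_eq_zero
  change ¬ IndIn G Finset.univ (D.u j + (Finsupp.single z 1 + a)).support
  rw [add_left_comm, he, support_single_add, hs]
  rintro ⟨_, h⟩
  obtain ⟨b, hb, hadj⟩ := hF.2 z hzF
  exact h z (Finset.mem_insert_self _ _) b (Finset.mem_insert_of_mem hb) hadj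

/-! ### Combinatorics of the ladder -/

/-- The infinite ladder. -/
def ladder : SimpleGraph (Bool × ℕ) where
  Adj p q := (p.1 = q.1 ∧ (p.2 + 1 = q.2 ∨ q.2 + 1 = p.2)) ∨ (p.1 ≠ q.1 ∧ p.2 = q.2)
  symm := ⟨by
    rintro ⟨s, i⟩ ⟨t, j⟩ h
    simp only at h ⊢
    rcases h with ⟨h1, h2⟩ | ⟨h1, h2⟩
    · exact Or.inl ⟨h1.symm, h2.symm⟩
    · exact Or.inr ⟨h1.symm, h2.symm⟩⟩
  loopless := ⟨by
    rintro ⟨s, i⟩ h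
    simp at h⟩

theorem ladder_adj (s t : Bool) (i j : ℕ) : ladder.Adj (s, i) (t, j) ↔
    (s = t ∧ (i + 1 = j ∨ j + 1 = i)) ∨ (s ≠ t ∧ i = j) := Iff.rfl

/-- The part of the ladder that remains after removing the first rungs. -/
def Rset (n j : ℕ) (s : Bool) : Finset (Bool × ℕ) :=
  (Finset.univ ×ˢ Finset.range (n + 2)).filter
    (fun p => ((p.1 = false ∧ p.2 ≤ n) ∨ (p.1 = true ∧ 1 ≤ p.2)) ∧
      ((p.1 = s ∧ p.2 = j) ∨ j + 1 ≤ p.2))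

theorem mem_Rset (n j : ℕ) (s t : Bool) (i : ℕ) : (t, i) ∈ Rset n j s ↔
    ((t = false ∧ i ≤ n) ∨ (t = true ∧ 1 ≤ i ∧ i ≤ n + 1)) ∧ ((t = s ∧ i = j) ∨ j + 1 ≤ i) := by
  simp only [Rset, Finset.mem_filter, Finset.mem_product, Finset.mem_univ, Finset.mem_range,
    true_and]
  cases t <;> cases s <;> simp <;> omega

/-- The value of the depth on the remaining part. -/
def val (s : Bool) (k : ℕ) : ℕ := if s then 2 * ((k + 1) / 4) + 1 else 2 * ((k + 3) / 4)

theorem Lo.step_of {V : Type*} {G : SimpleGraph V} {d : ℕ} {W W1 W2 : Finset V} (v : V)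
    (hv : v ∈ W) (e1 : ∀ w, w ∈ W1 ↔ w ∈ W ∧ w ≠ v) (e2 : ∀ w, w ∈ W2 ↔ w ∈ W ∧ ¬ G.Adj v w)
    (h1 : Lo G d W1) (h2 : Lo G d W2) : Lo G d W := by
  classical
  refine Lo.step W v hv ?_ ?_
  · convert h1 using 1
    ext w
    rw [e1, Finset.mem_erase, and_comm]
  · convert h2 using 1
    ext w
    rw [e2, Finset.mem_filter]

theorem Lo.mono {V : Type*} {G : SimpleGraph V} {d d' : ℕ} (hd : d' ≤ d) {W : Finset V}
    (h : Lo G d W) : Lo G d' W := by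
  induction h with
  | base W h hd2 => exact Lo.base W h (hd.trans hd2)
  | step W v hv _ _ ih1 ih2 => exact Lo.step W v hv ih1 ih2

theorem val_del (s : Bool) (k : ℕ) : val s (k + 1) ≤ 1 + val (!s) k := by
  cases s <;> simp [val] <;> omega

theorem val_colon (s : Bool) (k : ℕ) : val s (k + 2) = 1 + val (!s) k := by
  cases s <;> simp [val] <;> omega

set_option maxHeartbeats 1000000 in
theorem Lo_ladder (n : ℕ) (hn : 1 ≤ n) (k : ℕ) : ∀ (j : ℕ) (s : Bool) (T : Finset (Bool × ℕ)),
    j + k = n + 1 → (s = true → 1 ≤ j) → (∀ a ∈ T, ∀ b ∈ T, ¬ ladder.Adj a b) →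
    (∀ a ∈ T, ∀ b ∈ Rset n j s, ¬ ladder.Adj a b ∧ a ≠ b) →
    Lo ladder (T.card + val s k) (T ∪ Rset n j s) := by
  induction k using Nat.strong_induction_on with
  | _ k ih =>
  intro j s T hjk hs hT hTR
  have hindep : (∀ a ∈ Rset n j s, ∀ b ∈ Rset n j s, ¬ ladder.Adj a b) →
      ∀ a ∈ T ∪ Rset n j s, ∀ b ∈ T ∪ Rset n j s, ¬ ladder.Adj a b := by
    intro h a ha b hb
    rw [Finset.mem_union] at ha hb
    rcases ha with ha | ha <;> rcases hb with hb | hb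
    · exact hT a ha b hb
    · exact (hTR a ha b hb).1
    · exact fun hab => (hTR b hb a ha).1 hab.symm
    · exact h a ha b hb
  have hcard : (T ∪ Rset n j s).card = T.card + (Rset n j s).card := by
    apply Finset.card_union_of_disjoint
    rw [Finset.disjoint_left]
    exact fun a ha hb => (hTR a ha a hb).2 rfl
  by_cases hbase : k = 0 ∨ (k = 1 ∧ s = false)
  · apply Lo.base
    · apply hindep
      rintro ⟨t, i⟩ ha ⟨t', i'⟩ hb
      rw [mem_Rset] at ha hb
      rw [ladder_adj]
      clear ih hT hTR hindep hcard
      cases s <;> cases t <;> cases t' <;> simp at hs ha hb hbase ⊢ <;> omega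
    · rw [hcard]
      apply Nat.add_le_add_left
      rcases hbase with rfl | ⟨rfl, rfl⟩
      · cases s
        · simp [val]
        · simp only [val, if_true]
          norm_num
          refine ⟨(true, n + 1), ?_⟩
          rw [mem_Rset]
          simp; omega
      · have h2 : ({(false, n), (true, n + 1)} : Finset (Bool × ℕ)) ⊆ Rset n j false := by
          intro p hp
          simp only [Finset.mem_insert, Finset.mem_singleton] at hp
          rcases hp with rfl | rfl <;> rw [mem_Rset] <;> simp <;> omega
        have h3 := Finset.card_le_card h2
        rw [Finset.card_pair (by simp)] at h3
        simpa [val] using h3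
  · obtain ⟨k, rfl⟩ : ∃ k', k = k' + 1 := ⟨k - 1, by omega⟩
    have hsj : (s, j) ∈ Rset n j s := by
      rw [mem_Rset]
      cases s <;> simp at hs ⊢ <;> omega
    have hvR : (s, j + 1) ∈ Rset n j s := by
      rw [mem_Rset]
      cases s <;> simp at hs hbase ⊢ <;> omega
    refine Lo.step_of (s, j + 1) (Finset.mem_union_right _ hvR)
      (W1 := insert (s, j) T ∪ Rset n (j + 1) (!s))
      (W2 := insert (s, j + 1) T ∪ Rset n (j + 2) (!s)) ?_ ?_ ?_ ?_
    · rintro ⟨t, i⟩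
      simp only [Finset.mem_union, Finset.mem_insert]
      by_cases hT' : (t, i) ∈ T
      · have := (hTR _ hT' _ hvR).2
        simp [hT', this]
      · simp only [hT', mem_Rset, Prod.mk.injEq]
        cases s <;> cases t <;> simp at hs hbase ⊢ <;> omega
    · rintro ⟨t, i⟩
      simp only [Finset.mem_union, Finset.mem_insert]
      by_cases hT' : (t, i) ∈ T
      · have : ¬ ladder.Adj (s, j + 1) (t, i) := fun h => (hTR _ hT' _ hvR).1 h.symm
        simp [hT', this]
      · simp only [hT', mem_Rset, Prod.mk.injEq, ladder_adj]
        cases s <;> cases t <;> simp at hs hbase ⊢ <;> omega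
    · have h1 := ih k (by omega) (j + 1) (!s) (insert (s, j) T) (by omega) (by intro _; omega)
        ?_ ?_
      · refine h1.mono ?_
        rw [Finset.card_insert_of_notMem (fun h => (hTR _ h _ hsj).2 rfl)]
        have := val_del s k
        omega
      · intro a ha b hb
        rw [Finset.mem_insert] at ha hb
        rcases ha with rfl | ha <;> rcases hb with rfl | hb
        · exact ladder.loopless.irrefl _
        · exact fun h => (hTR b hb _ hsj).1 h.symm
        · exact (hTR a ha _ hsj).1
        · exact hT a ha b hb
      · rintro a ha ⟨t, i⟩ hb
        have hb' : (t, i) ∈ Rset n j s := by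
          rw [mem_Rset] at hb ⊢
          exact ⟨hb.1, by omega⟩
        rw [Finset.mem_insert] at ha
        rcases ha with rfl | ha
        · rw [mem_Rset] at hb
          rw [ladder_adj]
          cases s <;> cases t <;> simp at hs hbase hb ⊢ <;> omega
        · exact hTR a ha _ hb'
    · have hT1 : ∀ a ∈ insert (s, j + 1) T, ∀ b ∈ insert (s, j + 1) T, ¬ ladder.Adj a b := by
        intro a ha b hb
        rw [Finset.mem_insert] at ha hb
        rcases ha with rfl | ha <;> rcases hb with rfl | hb
        · exact ladder.loopless.irrefl _
        · exact fun h => (hTR b hb _ hvR).1 h.symm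
        · exact (hTR a ha _ hvR).1
        · exact hT a ha b hb
      have hc1 : (insert (s, j + 1) T).card = T.card + 1 :=
        Finset.card_insert_of_notMem (fun h => (hTR _ h _ hvR).2 rfl)
      by_cases hk : k = 0
      · have hempty : Rset n (j + 2) (!s) = ∅ := by
          apply Finset.eq_empty_of_forall_notMem
          rintro ⟨t, i⟩ h
          rw [mem_Rset] at h
          cases s <;> cases t <;> simp at h <;> omega
        rw [hempty, Finset.union_empty]
        refine Lo.base _ hT1 ?_
        rw [hc1]
        subst hk
        cases s <;> simp at hbase
        simp [val]
      · obtain ⟨k, rfl⟩ : ∃ k', k = k' + 1 := ⟨k - 1, by omega⟩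
        have h1 := ih k (by omega) (j + 2) (!s) (insert (s, j + 1) T) (by omega)
          (by intro _; omega) hT1 ?_
        · refine h1.mono ?_
          rw [hc1]
          have : val s (k + 1 + 1) = 1 + val (!s) k := val_colon s k
          omega
        · rintro a ha ⟨t, i⟩ hb
          have hb' : (t, i) ∈ Rset n j s := by
            rw [mem_Rset] at hb ⊢
            exact ⟨hb.1, by omega⟩
          rw [Finset.mem_insert] at ha
          rcases ha with rfl | ha
          · rw [mem_Rset] at hb
            rw [ladder_adj]
            cases s <;> cases t <;> simp at hs hbase hb ⊢ <;> omega
          · exact hTR a ha _ hb'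

theorem Max_ladder (n : ℕ) (k : ℕ) : ∀ (j : ℕ) (s : Bool),
    j + k = n + 1 → (s = true → 1 ≤ j) →
    ∃ F ⊆ Rset n j s, F.card ≤ val s k ∧ (∀ a ∈ F, ∀ b ∈ F, ¬ ladder.Adj a b) ∧
      ∀ p ∈ Rset n j s, p ∉ F → ∃ a ∈ F, ladder.Adj p a := by
  induction k using Nat.strong_induction_on with
  | _ k ih =>
  intro j s hjk hs
  match k, s with
  | 0, false =>
    refine ⟨∅, Finset.empty_subset _, by simp, by simp, ?_⟩
    rintro ⟨t, i⟩ h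
    rw [mem_Rset] at h
    cases t <;> simp at h <;> omega
  | 0, true =>
    refine ⟨{(true, n + 1)}, ?_, by simp [val], ?_, ?_⟩
    · rw [Finset.singleton_subset_iff, mem_Rset]
      simp; omega
    · simp
    · rintro ⟨t, i⟩ h h2
      rw [mem_Rset] at h
      cases t <;> simp at h h2 <;> omega
  | 1, false =>
    refine ⟨{(false, n), (true, n + 1)}, ?_, ?_, ?_, ?_⟩
    · intro p hp
      simp only [Finset.mem_insert, Finset.mem_singleton] at hp
      rcases hp with rfl | rfl <;> rw [mem_Rset] <;> simp <;> omega
    · rw [Finset.card_pair (by simp)]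
      simp [val]
    · simp [ladder_adj]
    · rintro ⟨t, i⟩ h h2
      rw [mem_Rset] at h
      cases t <;> simp at h h2 <;> omega
  | 1, true =>
    refine ⟨{(true, n + 1)}, ?_, by simp [val], ?_, ?_⟩
    · rw [Finset.singleton_subset_iff, mem_Rset]
      simp; omega
    · simp
    · rintro ⟨t, i⟩ h h2
      refine ⟨_, Finset.mem_singleton_self _, ?_⟩
      rw [mem_Rset] at h
      rw [ladder_adj]
      cases t <;> simp at h h2 ⊢ <;> omega
  | k + 2, s =>
    obtain ⟨F, hF1, hF2, hF3, hF4⟩ := ih k (by omega) (j + 2) (!s) (by omega) (by intro _; omega)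
    refine ⟨insert (s, j + 1) F, ?_, ?_, ?_, ?_⟩
    · rintro ⟨t, i⟩ hp
      rw [Finset.mem_insert] at hp
      rcases hp with h | h
      · rw [mem_Rset]
        simp only [Prod.mk.injEq] at h
        obtain ⟨rfl, rfl⟩ := h
        cases t <;> simp <;> omega
      · have h := hF1 h
        rw [mem_Rset] at h ⊢
        exact ⟨h.1, by omega⟩
    · refine (Finset.card_insert_le _ _).trans ?_
      have := val_colon s k
      omega
    · have hv : ∀ b ∈ F, ¬ ladder.Adj (s, j + 1) b := by
        rintro ⟨t, i⟩ hb
        have h := hF1 hb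
        rw [mem_Rset] at h
        rw [ladder_adj]
        cases s <;> cases t <;> simp at h ⊢ <;> omega
      intro a ha b hb
      rw [Finset.mem_insert] at ha hb
      rcases ha with rfl | ha <;> rcases hb with rfl | hb
      · exact ladder.loopless.irrefl _
      · exact hv b hb
      · exact fun h => hv a ha h.symm
      · exact hF3 a ha b hb
    · rintro ⟨t, i⟩ hp hpF
      rw [Finset.mem_insert, not_or] at hpF
      by_cases h : (t, i) ∈ Rset n (j + 2) (!s)
      · obtain ⟨a, ha, hadj⟩ := hF4 _ h hpF.2
        exact ⟨a, Finset.mem_insert_of_mem ha, hadj⟩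
      · refine ⟨_, Finset.mem_insert_self _ _, ?_⟩
        have hne := hpF.1
        clear hF1 hF4 hF3 hpF hF2 ih
        rw [mem_Rset] at h hp
        rw [ladder_adj]
        cases s <;> cases t <;> simp at h hp hne ⊢ <;> omega

/-! ### Transfer to `graphD` -/

theorem Lo_transfer {V V' : Type*} (G : SimpleGraph V) (G' : SimpleGraph V') (f : V ↪ V')
    (hf : ∀ a b, G.Adj a b ↔ G'.Adj (f a) (f b)) (d : ℕ) (W' : Finset V') (h : Lo G' d W') :
    ∀ W : Finset V, W.map f = W' → Lo G d W := by
  induction h with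
  | base W' h hd =>
    rintro W rfl
    refine Lo.base W ?_ (by simpa using hd)
    intro a ha b hb
    rw [hf]
    exact h _ (Finset.mem_map_of_mem f ha) _ (Finset.mem_map_of_mem f hb)
  | step W' v hv _ _ ih1 ih2 =>
    classical
    rintro W rfl
    obtain ⟨w, hw, rfl⟩ := Finset.mem_map.1 hv
    refine Lo.step W w hw (ih1 _ ?_) (ih2 _ ?_)
    · ext x
      simp only [Finset.mem_map, Finset.mem_erase]
      constructor
      · rintro ⟨a, ⟨h1, h2⟩, rfl⟩
        exact ⟨fun h => h1 (f.injective h), a, h2, rfl⟩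
      · rintro ⟨h1, a, h2, rfl⟩
        exact ⟨a, ⟨fun h => h1 (by rw [h]), h2⟩, rfl⟩
    · ext x
      simp only [Finset.mem_map, Finset.mem_filter]
      constructor
      · rintro ⟨a, ⟨h1, h2⟩, rfl⟩
        exact ⟨⟨a, h1, rfl⟩, fun h => h2 ((hf _ _).2 h)⟩
      · rintro ⟨⟨a, h2, rfl⟩, h1⟩
        exact ⟨a, ⟨h2, fun h => h1 ((hf _ _).1 h)⟩, rfl⟩

/-- Coordinates of the vertices of `graphD n` in the infinite ladder. -/
def posD (n : ℕ) : (Fin (n + 1) ⊕ Fin (n + 1)) ↪ Bool × ℕ where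
  toFun
    | .inl i => (false, if (i : ℕ) = n then 0 else (i : ℕ) + 1)
    | .inr i => (true, (i : ℕ) + 1)
  inj' := by
    rintro (i | i) (j | j) h <;> simp only [Prod.mk.injEq, reduceCtorEq, false_and, true_and] at h
    · congr 1
      ext
      split_ifs at h <;> omega
    · congr 1
      ext
      omega

theorem posD_inl (n : ℕ) (i : Fin (n + 1)) :
    posD n (.inl i) = (false, if (i : ℕ) = n then 0 else (i : ℕ) + 1) := rfl

theorem posD_inr (n : ℕ) (i : Fin (n + 1)) : posD n (.inr i) = (true, (i : ℕ) + 1) := rfl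

theorem posD_adj (n : ℕ) (hn : 2 ≤ n) (a b : Fin (n + 1) ⊕ Fin (n + 1)) :
    (graphD n).Adj a b ↔ ladder.Adj (posD n a) (posD n b) := by
  rcases a with i | i <;> rcases b with j | j <;>
    simp only [graphD, SimpleGraph.fromRel_adj, posD_inl, posD_inr, ladder_adj, ne_eq,
      Sum.inl.injEq, Sum.inr.injEq, Fin.ext_iff, reduceCtorEq, not_false_eq_true, true_and,
      false_and, or_false, false_or, not_true_eq_false] <;>
    have hi := i.2 <;> have hj := j.2 <;> (try split_ifs) <;> (try simp) <;> omega

theorem posD_univ (n : ℕ) : Finset.univ.map (posD n) = Rset n 0 false := by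
  ext ⟨t, i⟩
  rw [mem_Rset]
  simp only [Finset.mem_map, Finset.mem_univ, true_and]
  constructor
  · rintro ⟨j | j, h⟩
    · rw [posD_inl] at h
      have := j.2
      simp only [Prod.mk.injEq] at h
      obtain ⟨rfl, rfl⟩ := h
      split_ifs <;> simp <;> omega
    · rw [posD_inr] at h
      have := j.2
      simp only [Prod.mk.injEq] at h
      obtain ⟨rfl, rfl⟩ := h
      simp; omega
  · intro h
    cases t
    · simp at h
      by_cases hi : i = 0
      · exact ⟨.inl ⟨n, by omega⟩, by simp [posD_inl, hi]⟩
      · refine ⟨.inl ⟨i - 1, by omega⟩, ?_⟩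
        simp only [posD_inl, Prod.mk.injEq, true_and]
        split_ifs <;> omega
    · simp at h
      refine ⟨.inr ⟨i - 1, by omega⟩, ?_⟩
      simp only [posD_inr, Prod.mk.injEq, true_and]
      omega

theorem Lo_graphD (n : ℕ) (hn : 2 ≤ n) : Lo (graphD n) (2 * (n / 4) + 2) Finset.univ := by
  refine Lo_transfer (graphD n) ladder (posD n) (posD_adj n hn) _ _ ?_ _ (posD_univ n)
  have h := Lo_ladder n (by omega) (n + 1) 0 false ∅ (by omega) (by simp) (by simp) (by simp)
  rw [Finset.empty_union] at h
  refine h.mono ?_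
  simp [val]; omega

theorem Max_graphD (n : ℕ) (hn : 2 ≤ n) :
    ∃ F, MaxInd (graphD n) F ∧ F.card ≤ 2 * (n / 4) + 2 := by
  classical
  obtain ⟨F, h1, h2, h3, h4⟩ := Max_ladder n (n + 1) 0 false (by omega) (by simp)
  refine ⟨Finset.univ.filter (fun v => posD n v ∈ F), ⟨?_, ?_⟩, ?_⟩
  · intro a ha b hb
    rw [posD_adj n hn]
    exact h3 _ (Finset.mem_filter.1 ha).2 _ (Finset.mem_filter.1 hb).2
  · intro v hv
    have hv1 : posD n v ∈ Rset n 0 false := by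
      rw [← posD_univ]
      exact Finset.mem_map_of_mem _ (Finset.mem_univ _)
    obtain ⟨a, ha, hadj⟩ := h4 _ hv1 (fun h => hv (Finset.mem_filter.2 ⟨Finset.mem_univ _, h⟩))
    have ha1 := h1 ha
    rw [← posD_univ] at ha1
    obtain ⟨w, _, rfl⟩ := Finset.mem_map.1 ha1
    exact ⟨w, Finset.mem_filter.2 ⟨Finset.mem_univ _, ha⟩, (posD_adj n hn _ _).2 hadj⟩
  · rw [← Finset.card_map (posD n)]
    refine (Finset.card_le_card (t := F) ?_).trans (h2.trans ?_)
    · intro p hp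
      obtain ⟨w, hw, rfl⟩ := Finset.mem_map.1 hp
      exact (Finset.mem_filter.1 hw).2
    · simp [val]; omega

theorem depth_graphD (n : ℕ) (hn : 2 ≤ n) (K : Type*) [Field K] :
    depthQuot (edgeIdeal K (graphD n)) = 2 * (n / 4) + 2 := by
  obtain ⟨F, hF, hc⟩ := Max_graphD n hn
  refine IsGreatest.csSup_eq ⟨depth_lower K (graphD n) _ (Lo_graphD n hn), ?_⟩
  rintro _ ⟨rs, rfl, h1, h2⟩
  exact (depth_upper K (graphD n) F hF rs h1 h2).trans hc

theorem sdepth_graphD (n : ℕ) (hn : 2 ≤ n) (K : Type*) [Field K] :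
    sdepthQuot (edgeIdeal K (graphD n)) = 2 * (n / 4) + 2 := by
  obtain ⟨F, hF, hc⟩ := Max_graphD n hn
  refine IsGreatest.csSup_eq ⟨sdepth_lower K (graphD n) _ (Lo_graphD n hn), ?_⟩
  rintro d ⟨D, hD⟩
  obtain ⟨j, hj⟩ := sdepth_upper K (graphD n) F hF D
  exact (hD j).trans (hj.trans hc)

theorem ceil_half (n : ℕ) : ⌈((n : ℚ) + 1) / 2⌉₊ = n / 2 + 1 := by
  rw [Nat.ceil_eq_iff (by omega)]
  have h1 : n = 2 * (n / 2) + n % 2 := by omega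
  have h2 : n % 2 < 2 := Nat.mod_lt _ (by omega)
  have h3 : (n : ℚ) = 2 * ((n / 2 : ℕ) : ℚ) + ((n % 2 : ℕ) : ℚ) := by exact_mod_cast h1
  have h4 : ((n % 2 : ℕ) : ℚ) ≤ 1 := by exact_mod_cast (by omega : n % 2 ≤ 1)
  have h5 : (0 : ℚ) ≤ ((n % 2 : ℕ) : ℚ) := Nat.cast_nonneg _
  constructor
  · simp only [add_tsub_cancel_right]
    linarith
  · push_cast at *
    linarith

theorem depth_sdepth_graphD (n : ℕ) (hn : 2 ≤ n) (K : Type*) [Field K] :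
    depthQuot (edgeIdeal K (graphD n)) = sdepthQuot (edgeIdeal K (graphD n)) ∧
    ((n % 4 = 0 ∨ n % 4 = 1) → depthQuot (edgeIdeal K (graphD n)) = ⌈((n : ℚ) + 1) / 2⌉₊ + 1) ∧
    ((n % 4 = 2 ∨ n % 4 = 3) → depthQuot (edgeIdeal K (graphD n)) = ⌈((n : ℚ) + 1) / 2⌉₊) := by
  rw [depth_graphD n hn K, sdepth_graphD n hn K, ceil_half]
  refine ⟨rfl, fun h => ?_, fun h => ?_⟩ <;> omega
end
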